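/- arXiv:1512.01799 — 7 statements merged into one kernel-verified Lean document; each statement's English description precedes it below -/
import Mathlib

section
/- Let n ≥ 2 and let x be an element of a commutative ring (e.g. x ∈ ℝ). Then: (i) Σ_{π ∈ S_{n,1}} x^{exc(π)} (−1)^{cdes(π)} = (1+x)^{n−2}; (ii) for every i with 2 ≤ i ≤ n−1, Σ_{π ∈ S_{n,i}} x^{exc(π)} (−1)^{cdes(π)} = 0; (iii) Σ_{π ∈ S_{n,n}} x^{exc(π)} (−1)^{cdes(π)} = x(1+x)^{n−2}. -/
open Equiv Finset

/-- Number of excedances of a permutation of `Fin n` (`π i > i`). -/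
def exc {n : ℕ} (π : Equiv.Perm (Fin n)) : ℕ :=
  (Finset.univ.filter fun i => i < π i).card

/-- Number of fixed points. -/
def fixpts {n : ℕ} (π : Equiv.Perm (Fin n)) : ℕ :=
  (Finset.univ.filter fun i => π i = i).card

/-- The set of cycle descents of `π`: those `c` with `π c < c` such that `π c`
is not the smallest element of the cycle containing `c`. -/
def cdesSet {n : ℕ} (π : Equiv.Perm (Fin n)) : Finset (Fin n) :=
  Finset.univ.filter fun c => π c < c ∧ ∃ j, π.SameCycle c j ∧ j < π c

/-- The number of cycle descents of `π`. -/
def cdes {n : ℕ} (π : Equiv.Perm (Fin n)) : ℕ := (cdesSet π).card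

/-- The number of cycles of `π`, counted via cycle minima. -/
def cyc {n : ℕ} (π : Equiv.Perm (Fin n)) : ℕ :=
  (Finset.univ.filter fun c : Fin n => ∀ j, π.SameCycle c j → c ≤ j).card
lemma card_closers {n : ℕ} (π : Equiv.Perm (Fin n)) :
    (Finset.univ.filter fun c => π c < c ∧ ¬ ∃ j, π.SameCycle c j ∧ j < π c).card
      = π.cycleFactorsFinset.card := by
  apply Finset.card_bij (fun c _ => π.cycleOf c)
  · intro c hc
    simp only [Finset.mem_filter, Finset.mem_univ, true_and] at hc
    rw [Equiv.Perm.cycleOf_mem_cycleFactorsFinset_iff, Equiv.Perm.mem_support]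
    exact hc.1.ne
  · intro a ha b hb hab
    simp only [Finset.mem_filter, Finset.mem_univ, true_and, not_exists, not_and, not_lt] at ha hb
    have hs : π.SameCycle a b :=
      (Equiv.Perm.sameCycle_iff_cycleOf_eq_of_mem_support
        (Equiv.Perm.mem_support.2 ha.1.ne) (Equiv.Perm.mem_support.2 hb.1.ne)).2 hab
    have h1 := ha.2 (π b) (Equiv.Perm.sameCycle_apply_right.2 hs)
    have h2 := hb.2 (π a) (Equiv.Perm.sameCycle_apply_right.2 hs.symm)
    exact π.injective (le_antisymm h1 h2)
  · intro g hg
    have hcyc := (Equiv.Perm.mem_cycleFactorsFinset_iff.1 hg).1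
    have hne : g.support.Nonempty := Finset.nonempty_iff_ne_empty.2 (by
      intro h
      exact hcyc.ne_one (Equiv.Perm.support_eq_empty_iff.1 h))
    set m := g.support.min' hne with hm
    have hmem : m ∈ g.support := Finset.min'_mem _ _
    have hgm : g = π.cycleOf m := Equiv.Perm.cycle_is_cycleOf hmem hg
    have hms : π m ≠ m := by
      have := Equiv.Perm.cycleOf_mem_cycleFactorsFinset_iff.1 (hgm ▸ hg)
      exact Equiv.Perm.mem_support.1 this
    have hmin : ∀ j, π.SameCycle m j → m ≤ j := by
      intro j hj
      apply Finset.min'_le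
      rw [hgm]
      exact (Equiv.Perm.mem_support_cycleOf_iff' hms).2 hj
    have hpi : π (π⁻¹ m) = m := by simp
    have hsc : π.SameCycle m (π⁻¹ m) := by
      rw [← Equiv.Perm.sameCycle_apply_right, hpi]
    refine ⟨π⁻¹ m, ?_, ?_⟩
    · simp only [Finset.mem_filter, Finset.mem_univ, true_and, not_exists, not_and, not_lt, hpi]
      refine ⟨lt_of_le_of_ne (hmin _ hsc) ?_, fun j hj => hmin j (hsc.trans hj)⟩
      intro h
      rw [← h] at hpi
      exact hms hpi
    · rw [hgm]
      exact hsc.symm.cycleOf_eq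

lemma sign_eq {n : ℕ} (π : Equiv.Perm (Fin n)) :
    Equiv.Perm.sign π * (-1) ^ exc π = (-1 : ℤˣ) ^ cdes π := by
  have h1 : π.support.card = exc π + (Finset.univ.filter fun c => π c < c).card := by
    unfold exc
    rw [← Finset.card_union_of_disjoint]
    · congr 1
      ext c
      simp only [Equiv.Perm.mem_support, Finset.mem_union, Finset.mem_filter, Finset.mem_univ,
        true_and]
      exact ne_iff_lt_or_gt.trans or_comm
    · rw [Finset.disjoint_filter]
      intro c _ h h'
      exact lt_asymm h h'
  have h2 : (Finset.univ.filter fun c => π c < c).card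
      = cdes π + π.cycleFactorsFinset.card := by
    rw [← card_closers, cdes, cdesSet, ← Finset.filter_filter, ← Finset.filter_filter,
      Finset.card_filter_add_card_filter_not]
  have h3 : Multiset.card π.cycleType = π.cycleFactorsFinset.card := by
    simp [Equiv.Perm.cycleType_def]
  rw [Equiv.Perm.sign_of_cycleType, Equiv.Perm.sum_cycleType, h3, h1, h2, ← pow_add]
  rw [show exc π + (cdes π + π.cycleFactorsFinset.card) + π.cycleFactorsFinset.card + exc π
    = 2 * (exc π + π.cycleFactorsFinset.card) + cdes π by ring, pow_add, pow_mul]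
  simp

lemma weight_eq {n : ℕ} (π : Equiv.Perm (Fin n)) (x : ℝ) :
    x ^ exc π * (-1 : ℝ) ^ cdes π =
      ((Equiv.Perm.sign π : ℤ) : ℝ) * ∏ k, (if k < π k then -x else 1) := by
  have h := congrArg (fun u : ℤˣ => ((u : ℤ) : ℝ)) (sign_eq π)
  simp only [Units.val_mul, Units.val_pow_eq_pow_val, Units.val_neg, Units.val_one,
    Int.cast_mul, Int.cast_pow, Int.cast_neg, Int.cast_one] at h
  rw [← h, Finset.prod_ite, Finset.prod_const, Finset.prod_const_one, mul_one, neg_pow x]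
  unfold exc
  ring

/-- The full matrix. -/
def matM (m : ℕ) (x : ℝ) : Matrix (Fin (m + 2)) (Fin (m + 2)) ℝ :=
  fun l k => if k < l then -x else 1

/-- The matrix with column `i` replaced by the first basis vector. -/
def matN (m : ℕ) (x : ℝ) (i : Fin (m + 2)) : Matrix (Fin (m + 2)) (Fin (m + 2)) ℝ :=
  fun l k => if k = i then (if l = 0 then 1 else 0) else if k < l then -x else 1

lemma sum_all (m : ℕ) (x : ℝ) :
    ∑ π : Equiv.Perm (Fin (m + 2)), x ^ exc π * (-1 : ℝ) ^ cdes π = (matM m x).det := by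
  rw [Matrix.det_apply']
  exact Finset.sum_congr rfl fun π _ => weight_eq π x

lemma sum_i (m : ℕ) (x : ℝ) (i : Fin (m + 2)) :
    ∑ π ∈ Finset.univ.filter (fun π : Equiv.Perm (Fin (m + 2)) => π i = 0),
      x ^ exc π * (-1 : ℝ) ^ cdes π = (matN m x i).det := by
  rw [Matrix.det_apply', Finset.sum_filter]
  refine Finset.sum_congr rfl fun π _ => ?_
  split_ifs with h
  · rw [weight_eq]
    congr 1
    refine Finset.prod_congr rfl fun k _ => ?_
    unfold matN
    by_cases hk : k = i
    · subst hk
      simp [h]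
    · simp [hk]
  · rw [Finset.prod_eq_zero (Finset.mem_univ i), mul_zero]
    simp [matN, h]

lemma det_M (m : ℕ) (x : ℝ) : (matM m x).det = (1 + x) ^ (m + 1) := by
  let B : Matrix (Fin (m + 2)) (Fin (m + 2)) ℝ := fun l k =>
    if (k : ℕ) = 0 then (if (l : ℕ) = 0 then 1 else -x) else if (l : ℕ) = k then 1 + x else 0
  have h : (matM m x).det = B.det := by
    apply Matrix.det_eq_of_forall_col_eq_smul_add_pred (fun _ => 1)
    · intro l
      simp only [matM, B, Fin.lt_def, Fin.val_zero]
      split_ifs <;> first | contradiction | omega | rfl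
    · intro l j
      simp only [matM, B, Fin.lt_def, Fin.ext_iff, Fin.val_succ,
        Fin.val_castSucc]
      split_ifs <;> first | contradiction | omega | ring
  rw [h, Matrix.det_of_lowerTriangular]
  · rw [Fin.prod_univ_succ]
    simp [B]
  · intro l k hlk
    have hlk' : l < k := hlk
    simp only [Fin.lt_def] at hlk'
    simp only [B]
    split_ifs <;> first | omega | rfl

lemma det_N_zero (m : ℕ) (x : ℝ) : (matN m x 0).det = (1 + x) ^ m := by
  let B : Matrix (Fin (m + 2)) (Fin (m + 2)) ℝ := fun l k =>
    if (k : ℕ) = 0 then (if (l : ℕ) = 0 then 1 else 0)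
    else if (k : ℕ) = 1 then (if (l : ℕ) = 0 then 0 else if (l : ℕ) = 1 then 1 else -x)
    else if (l : ℕ) = k then 1 + x else 0
  have h : (matN m x 0).det = B.det := by
    apply Matrix.det_eq_of_forall_col_eq_smul_add_pred (fun _ => 1)
    · intro l
      simp [matN, B]
    · intro l j
      simp only [matN, B, Fin.lt_def, Fin.ext_iff, Fin.val_succ,
        Fin.val_castSucc, Fin.val_zero, Fin.val_one]
      split_ifs <;> first | contradiction | omega | ring
  rw [h, Matrix.det_of_lowerTriangular]
  · rw [Fin.prod_univ_succ, Fin.prod_univ_succ]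
    have : ∀ j : Fin m, B j.succ.succ j.succ.succ = 1 + x := by
      intro j
      simp [B]
    simp [this]
    simp [B]
  · intro l k hlk
    have hlk' : (l : ℕ) < k := hlk
    simp only [B]
    split_ifs <;> first | omega | rfl

lemma det_N_mid (m : ℕ) (x : ℝ) (i : Fin (m + 2)) (h0 : i ≠ 0) (h1 : i ≠ Fin.last (m + 1)) :
    (matN m x i).det = 0 := by
  have h01 : (Fin.last (m + 1)) ≠ 0 := by simp [Fin.ext_iff]
  apply Matrix.exists_mulVec_eq_zero_iff.1
  refine ⟨Pi.single 0 1 + Pi.single (Fin.last (m + 1)) x - Pi.single i (1 + x), ?_, ?_⟩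
  · intro h
    have := congrFun h 0
    simp [Pi.single_apply, h0.symm, h01.symm] at this
  · ext l
    simp only [Matrix.mulVec_sub, Matrix.mulVec_add, Matrix.mulVec_single, Pi.sub_apply,
      Pi.add_apply]
    have : ¬ Fin.last (m + 1) < l := not_lt.2 (Fin.le_last l)
    by_cases hl : l = 0
    · simp [matN, h0.symm, h1.symm, hl]
    · simp [matN, h0.symm, h1.symm, hl, this, Fin.pos_iff_ne_zero]

lemma sum_fiber (m : ℕ) (x : ℝ) : (matM m x).det = ∑ i, (matN m x i).det := by
  rw [← sum_all]
  simp_rw [← sum_i, Finset.sum_filter]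
  rw [Finset.sum_comm]
  refine Finset.sum_congr rfl fun π _ => ?_
  rw [Finset.sum_eq_single (π⁻¹ 0)]
  · simp
  · intro b _ hb
    rw [if_neg]
    intro h
    exact hb (by rw [← h]; simp)
  · simp

lemma det_N_last (m : ℕ) (x : ℝ) : (matN m x (Fin.last (m + 1))).det = x * (1 + x) ^ m := by
  have h := sum_fiber m x
  rw [det_M, Fin.sum_univ_castSucc, Fin.sum_univ_succ, Finset.sum_eq_zero, Fin.castSucc_zero,
    det_N_zero] at h
  · rw [pow_succ] at h
    linarith
  · intro j _
    apply det_N_mid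
    · simp [Fin.ext_iff]
    · simp only [ne_eq, Fin.ext_iff, Fin.val_castSucc, Fin.val_succ, Fin.val_last]
      omega

/-- The signed enumerator of permutations π of [n] with π(i) = 1 by excedances,
with sign (−1)^cdes: it is (1+x)^(n−2) for i = 1, zero for 2 ≤ i ≤ n−1,
and x(1+x)^(n−2) for i = n.  (Element 1 of [n] is encoded as 0 : Fin n, and
position i of [n] as ⟨i−1, _⟩ : Fin n.) -/
theorem signed_exc_enumerator_Sni (n : ℕ) (hn : 2 ≤ n) (x : ℝ) :
    (∑ π ∈ Finset.univ.filter
        (fun π : Equiv.Perm (Fin n) => π ⟨0, by omega⟩ = ⟨0, by omega⟩),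
        x ^ exc π * (-1 : ℝ) ^ cdes π) = (1 + x) ^ (n - 2) ∧
    (∀ i : ℕ, ∀ _h2 : 2 ≤ i, ∀ _h1 : i ≤ n - 1,
      (∑ π ∈ Finset.univ.filter
          (fun π : Equiv.Perm (Fin n) => π ⟨i - 1, by omega⟩ = ⟨0, by omega⟩),
          x ^ exc π * (-1 : ℝ) ^ cdes π) = 0) ∧
    (∑ π ∈ Finset.univ.filter
        (fun π : Equiv.Perm (Fin n) => π ⟨n - 1, by omega⟩ = ⟨0, by omega⟩),
        x ^ exc π * (-1 : ℝ) ^ cdes π) = x * (1 + x) ^ (n - 2) := by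
  obtain ⟨m, rfl⟩ : ∃ m, n = m + 2 := ⟨n - 2, by omega⟩
  refine ⟨?_, ?_, ?_⟩
  · exact (sum_i m x 0).trans (det_N_zero m x)
  · intro i h2 h1
    refine (sum_i m x ⟨i - 1, by omega⟩).trans (det_N_mid m x _ ?_ ?_)
    · simp only [ne_eq, Fin.ext_iff, Fin.val_zero]
      omega
    · simp only [ne_eq, Fin.ext_iff, Fin.val_last]
      omega
  · exact (sum_i m x (Fin.last (m + 1))).trans (det_N_last m x)
end

section
/- Let n ≥ 2, let 2 ≤ i ≤ n, and let x be an element of a commutative ring (e.g. x ∈ ℝ). Then Σ_{π ∈ D_{n,i}} x^{exc(π)} (−1)^{cdes(π)} = (−1)^{n−i} x^{i−1}, where D_{n,i} is the set of derangements π of [n] with π(i) = 1. -/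
open Equiv Finset

/-- each cycle of a derangement has a unique element mapped to the cycle minimum -/
lemma card_minpre {n : ℕ} (π : Equiv.Perm (Fin n)) (hπ : ∀ j, π j ≠ j) :
    (Finset.univ.filter fun c => π c < c ∧ ¬ ∃ j, π.SameCycle c j ∧ j < π c).card
      = π.cycleFactorsFinset.card := by
  have hs : ∀ j, j ∈ π.support := fun j => Equiv.Perm.mem_support.2 (hπ j)
  apply Finset.card_bij (fun c _ => π.cycleOf c)
  · intro c _
    exact Equiv.Perm.cycleOf_mem_cycleFactorsFinset_iff.2 (hs c)
  · intro a ha b hb hab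
    simp only [Finset.mem_filter, Finset.mem_univ, true_and, not_exists, not_and, not_lt] at ha hb
    have hsc : π.SameCycle a b :=
      (Equiv.Perm.sameCycle_iff_cycleOf_eq_of_mem_support (hs a) (hs b)).2 hab
    have h1 := ha.2 (π b) (Equiv.Perm.sameCycle_apply_right.2 hsc)
    have h2 := hb.2 (π a) (Equiv.Perm.sameCycle_apply_right.2 hsc.symm)
    exact π.injective (le_antisymm h1 h2)
  · intro f hf
    obtain ⟨hc, hfπ⟩ := Equiv.Perm.mem_cycleFactorsFinset_iff.1 hf
    have hne : f.support.Nonempty := by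
      rw [Finset.nonempty_iff_ne_empty, Ne, Equiv.Perm.support_eq_empty_iff]
      exact hc.ne_one
    set m := f.support.min' hne with hm
    have hmem : m ∈ f.support := Finset.min'_mem _ _
    have hfc : f = π.cycleOf m :=
      Equiv.Perm.cycle_is_cycleOf hmem hf
    have hmin : ∀ j, π.SameCycle m j → m ≤ j := by
      intro j hj
      apply Finset.min'_le
      rw [hfc, Equiv.Perm.mem_support_cycleOf_iff]
      exact ⟨hj, hs _⟩
    have hsm : π.SameCycle (π.symm m) m := by
      have := (Equiv.Perm.sameCycle_apply_right (f := π) (x := π.symm m) (y := π.symm m)).2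
        (Equiv.Perm.SameCycle.refl _ _)
      simpa using this
    refine ⟨π.symm m, ?_, ?_⟩
    · simp only [Finset.mem_filter, Finset.mem_univ, true_and, not_exists, not_and, not_lt,
        Equiv.apply_symm_apply]
      refine ⟨lt_of_le_of_ne (hmin _ hsm.symm) ?_, fun j hj => hmin j (hsm.symm.trans hj)⟩
      intro h
      apply hπ m
      conv_lhs => rw [h]
      simp
    · rw [hfc]
      exact hsm.cycleOf_eq

lemma sign_cdes {n : ℕ} (π : Equiv.Perm (Fin n)) (hπ : ∀ j, π j ≠ j) :
    (-1 : ℝ) ^ cdes π = ((Equiv.Perm.sign π : ℤ) : ℝ) * (-1) ^ exc π := by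
  have h1 := card_minpre π hπ
  have hsupp : π.support = Finset.univ := by
    ext j; simp [hπ j]
  have h2 : Equiv.Perm.sign π = (-1) ^ (n + π.cycleFactorsFinset.card) := by
    rw [Equiv.Perm.sign_of_cycleType, Equiv.Perm.sum_cycleType, hsupp,
      Equiv.Perm.cycleType_def]
    simp
  have h3 : n = exc π + (cdes π + π.cycleFactorsFinset.card) := by
    rw [← h1]
    unfold exc cdes cdesSet
    rw [← Finset.filter_filter, ← Finset.filter_filter, Finset.card_filter_add_card_filter_not]
    have := Finset.card_filter_add_card_filter_not (s := (Finset.univ : Finset (Fin n)))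
      (fun i => i < π i)
    rw [Finset.card_univ, Fintype.card_fin] at this
    conv_lhs => rw [← this]
    congr 2
    ext j
    simp only [Finset.mem_filter, Finset.mem_univ, true_and, not_lt]
    exact ⟨fun h => lt_of_le_of_ne h (hπ j), le_of_lt⟩
  rw [h2]
  generalize π.cycleFactorsFinset.card = c at *
  generalize cdes π = d at *
  generalize exc π = e at *
  subst h3
  push_cast
  rw [← pow_add, show e + (d + c) + c + e = d + 2 * (e + c) by ring, pow_add, pow_mul]
  simp

/-- The matrix with `-x` above the diagonal, `1` below and `0` on the diagonal. -/
def Mx (n : ℕ) (x : ℝ) : Matrix (Fin n) (Fin n) ℝ :=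
  Matrix.of fun j k => if j < k then -x else if k < j then 1 else 0

lemma adj_step (m : ℕ) (x : ℝ) (k : ℕ) (hk : 1 ≤ k) (hk2 : k + 1 < m + 2) :
    (Mx (m+2) x).adjugate 0 ⟨k+1, hk2⟩ = -x * (Mx (m+2) x).adjugate 0 ⟨k, by omega⟩ := by
  have h := Matrix.adjugate_mul (Mx (m+2) x)
  set v := (Mx (m+2) x).adjugate with hv
  have ha := congrFun (congrFun h 0) ⟨k, by omega⟩
  have hb := congrFun (congrFun h 0) ⟨k+1, hk2⟩
  rw [Matrix.mul_apply, Matrix.smul_apply, Matrix.one_apply_ne (by simp [Fin.ext_iff] <;> omega)] at ha hb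
  have hd : ∑ j, (v 0 j * Mx (m+2) x j ⟨k, by omega⟩ - v 0 j * Mx (m+2) x j ⟨k+1, hk2⟩) = 0 := by
    rw [Finset.sum_sub_distrib, ha, hb]; simp
  have he : ∀ j : Fin (m+2), (v 0 j * Mx (m+2) x j ⟨k, by omega⟩ - v 0 j * Mx (m+2) x j ⟨k+1, hk2⟩)
      = (if j = ⟨k+1, hk2⟩ then v 0 j else 0) + (if j = ⟨k, by omega⟩ then x * v 0 j else 0) := by
    intro j
    simp only [Mx, Matrix.of_apply, Fin.lt_def, Fin.ext_iff]
    split_ifs <;> first | omega | ring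
  simp only [he, Finset.sum_add_distrib, Finset.sum_ite_eq', Finset.mem_univ, if_true] at hd
  linarith

set_option maxHeartbeats 1000000 in
lemma adj_base (m : ℕ) (x : ℝ) : (Mx (m+2) x).adjugate 0 1 = (-1) ^ m * x := by
  rw [Matrix.adjugate_apply]
  let T : Matrix (Fin (m+2)) (Fin (m+2)) ℝ := Matrix.of fun j k =>
    if j.val = 0 then (if k.val = 0 then 1 else 0)
    else if k.val < j.val then 0
    else if j.val = 1 then 1 else if k.val = j.val then -1 else -x - 1
  let T1 : Matrix (Fin (m+2)) (Fin (m+2)) ℝ := Matrix.of fun j k =>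
    T j k + (if 2 ≤ j.val then 1 else 0) * T 0 k
  let T2 : Matrix (Fin (m+2)) (Fin (m+2)) ℝ := Matrix.of fun j k =>
    T1 j k + (if 2 ≤ j.val then 1 else 0) * T1 1 k
  have hT : T.det = (-1) ^ m := by
    rw [Matrix.det_of_isUpperTriangular]
    · rw [Fin.prod_univ_succ, Fin.prod_univ_succ]
      simp [T]
    · intro j k hjk
      have hjk' : k.val < j.val := hjk
      simp only [T, Matrix.of_apply]
      rw [if_neg (by omega), if_pos hjk']
  have hT1 : T1.det = T.det :=
    Matrix.det_eq_of_forall_row_eq_smul_add_const (fun j => if 2 ≤ j.val then 1 else 0) 0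
      (by simp) (fun i j => rfl)
  have hT2 : T2.det = T1.det :=
    Matrix.det_eq_of_forall_row_eq_smul_add_const (fun j => if 2 ≤ j.val then 1 else 0) 1
      (by simp) (fun i j => rfl)
  have hfin : (Mx (m+2) x).updateRow 1 (Pi.single 0 1)
      = (T2.updateRow 1 ((-x) • T2 1)).submatrix (Equiv.swap (0 : Fin (m+2)) 1) id := by
    ext j k
    have h01 : (0 : Fin (m+2)) ≠ 1 := by simp
    rw [Matrix.submatrix_apply]
    by_cases hj0 : j = 0
    · subst hj0
      rw [Equiv.swap_apply_left, Matrix.updateRow_self, Matrix.updateRow_ne h01]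
      simp only [Mx, T2, T1, T, Matrix.of_apply, Fin.lt_def, Pi.smul_apply, smul_eq_mul, id]
      simp
      split_ifs <;> first | omega | simp_all
    · by_cases hj1 : j = 1
      · subst hj1
        rw [Equiv.swap_apply_right, Matrix.updateRow_self, Matrix.updateRow_ne h01]
        simp [T2, T1, T, Pi.single_apply]
      · rw [Equiv.swap_apply_of_ne_of_ne hj0 hj1, Matrix.updateRow_ne hj1, Matrix.updateRow_ne hj1]
        have a0 : j.val ≠ 0 := fun h => hj0 (Fin.ext h)
        have a1 : j.val ≠ 1 := fun h => hj1 (Fin.ext (by simpa using h))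
        have a2 : 2 ≤ j.val := by omega
        have e0 : T 0 k = if k.val = 0 then 1 else 0 := by simp [T]
        have e1 : T 1 k = if k.val < 1 then 0 else 1 := by simp [T]
        have ej : T j k = if k.val < j.val then 0 else if k.val = j.val then -1 else -x - 1 := by
          simp only [T, Matrix.of_apply]
          rw [if_neg a0, if_neg a1]
        have eT : T2 j (id k) = T j k + T 0 k + T 1 k := by
          simp [T2, T1, a2]
        have eM : Mx (m+2) x j k
            = if j.val < k.val then -x else if k.val < j.val then 1 else 0 := rfl
        rw [eT, e0, e1, ej, eM]
        clear_value T T1 T2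
        rcases lt_trichotomy j.val k.val with h | h | h
        · rw [if_pos h, if_neg (by omega), if_neg (by omega), if_neg (by omega),
            if_neg (by omega)]
          ring
        · rw [if_neg (by omega), if_neg (by omega), if_neg (by omega), if_pos (by omega),
            if_neg (by omega), if_neg (by omega)]
          ring
        · rw [if_neg (by omega), if_pos h, if_pos h]
          by_cases hk : k.val = 0
          · simp [hk]
          · rw [if_neg hk, if_neg (by omega)]
            ring
  rw [hfin, Matrix.det_permute, Matrix.det_updateRow_smul, Matrix.updateRow_eq_self, hT2, hT1, hT,
    Equiv.Perm.sign_swap (by simp)]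
  push_cast
  ring

lemma adj_val (m : ℕ) (x : ℝ) (k : ℕ) (hk2 : k + 1 < m + 2) :
    (Mx (m+2) x).adjugate 0 ⟨k+1, hk2⟩ = (-1) ^ (m - k) * x ^ (k+1) := by
  induction k with
  | zero =>
    have := adj_base m x
    simpa using this
  | succ k ih =>
    rw [adj_step m x (k+1) (by omega) hk2, ih (by omega),
      show m - k = (m - (k+1)) + 1 by omega]
    ring

/-- For derangements π of [n] with π(i) = 1 (2 ≤ i ≤ n), the signed excedance
enumerator is (−1)^(n−i) x^(i−1).  (Element 1 of [n] is encoded as 0 : Fin n,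
and position i of [n] as ⟨i−1, _⟩ : Fin n.) -/
theorem signed_exc_enumerator_Dni (n i : ℕ) (hn : 2 ≤ n) (h2 : 2 ≤ i) (hin : i ≤ n)
    (x : ℝ) :
    (∑ π ∈ Finset.univ.filter
        (fun π : Equiv.Perm (Fin n) =>
          (∀ j, π j ≠ j) ∧ π ⟨i - 1, by omega⟩ = ⟨0, by omega⟩),
        x ^ exc π * (-1 : ℝ) ^ cdes π) = (-1 : ℝ) ^ (n - i) * x ^ (i - 1) := by
  obtain ⟨m, rfl⟩ : ∃ m, n = m + 2 := ⟨n - 2, by omega⟩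
  obtain ⟨k, rfl⟩ : ∃ k, i = k + 2 := ⟨i - 2, by omega⟩
  have hv := adj_val m x k (by omega)
  have e1 : m + 2 - (k + 2) = m - k := by omega
  rw [e1]
  change _ = (-1 : ℝ) ^ (m - k) * x ^ (k + 1)
  rw [← hv, Matrix.adjugate_apply, ← Matrix.det_transpose,
    Matrix.det_apply', Finset.sum_filter]
  apply Finset.sum_congr rfl
  intro σ _
  have hp : (⟨k + 2 - 1, by omega⟩ : Fin (m+2)) = ⟨k+1, by omega⟩ := rfl
  rw [hp]
  have h0 : (⟨0, by omega⟩ : Fin (m+2)) = 0 := rfl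
  rw [h0]
  set p : Fin (m+2) := ⟨k+1, by omega⟩ with hpdef
  have hp0 : (0 : Fin (m+2)) < p := by simp [hpdef, Fin.lt_def]
  simp only [Matrix.transpose_apply]
  split_ifs with h
  · obtain ⟨hd, hσ⟩ := h
    have hprod : ∀ j, (Mx (m+2) x).updateRow p (Pi.single 0 1) j (σ j)
        = if j < σ j then -x else 1 := by
      intro j
      by_cases hj : j = p
      · subst hj
        rw [Matrix.updateRow_self, hσ, if_neg (not_lt.2 hp0.le)]
        simp
      · rw [Matrix.updateRow_ne hj]
        simp only [Mx, Matrix.of_apply]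
        rcases lt_trichotomy j (σ j) with h | h | h
        · simp [h]
        · exact absurd h.symm (hd j)
        · simp [h, not_lt.2 h.le]
    rw [Finset.prod_congr rfl (fun j _ => hprod j), Finset.prod_ite]
    simp only [Finset.prod_const, one_pow, mul_one]
    rw [sign_cdes σ hd, neg_pow x]
    unfold exc
    ring
  · symm
    apply mul_eq_zero_of_right
    by_cases hσ : σ p = 0
    · have : ∃ j, σ j = j := by
        by_contra hc
        push Not at hc
        exact h ⟨hc, hσ⟩
      obtain ⟨j, hj⟩ := this
      apply Finset.prod_eq_zero (Finset.mem_univ j)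
      have hjp : j ≠ p := by
        rintro rfl
        rw [hj] at hσ
        exact hp0.ne' hσ
      rw [hj, Matrix.updateRow_ne hjp]
      simp [Mx]
    · apply Finset.prod_eq_zero (Finset.mem_univ p)
      rw [Matrix.updateRow_self]
      simp [hσ]
end

section
/- For n ≥ 1 define b_n(y) = Σ_{π ∈ S_n} y^{cdes(π)} for y in a commutative ring (e.g. y ∈ ℝ). Then b_1(y) = 1 and for all n ≥ 1, b_{n+1}(y) = b_n(y) + Σ_{i=1}^{n} b_i(y) · C(n, i−1) · (y−1)^{n−i}, where C(n,k) is the binomial coefficient. -/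
open Equiv Finset

/-- b_n(y) = Σ_{π ∈ S_n} y^{cdes(π)}. -/
noncomputable def bPoly (n : ℕ) (y : ℝ) : ℝ :=
  ∑ π : Equiv.Perm (Fin n), y ^ cdes π


/-- Extend a permutation of `Fin n` to one of `Fin (n+1)` fixing `k`. -/
def extPerm {n : ℕ} (k : Fin (n + 1)) (σ : Equiv.Perm (Fin n)) : Equiv.Perm (Fin (n + 1)) :=
  ((finSuccEquiv' k).trans (Equiv.optionCongr σ)).trans (finSuccEquiv' k).symm

lemma extPerm_self {n : ℕ} (k : Fin (n + 1)) (σ : Equiv.Perm (Fin n)) :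
    extPerm k σ k = k := by
  simp [extPerm]

lemma extPerm_succAbove {n : ℕ} (k : Fin (n + 1)) (σ : Equiv.Perm (Fin n)) (x : Fin n) :
    extPerm k σ (k.succAbove x) = k.succAbove (σ x) := by
  simp [extPerm]

lemma extPerm_injective {n : ℕ} (k : Fin (n + 1)) : Function.Injective (extPerm k) := by
  intro σ τ h
  ext x
  have := congrArg (fun p => p (k.succAbove x)) h
  simp only [extPerm_succAbove] at this
  rw [Fin.succAbove_right_injective this]

lemma extPerm_surj {n : ℕ} (k : Fin (n + 1)) (τ : Equiv.Perm (Fin (n + 1))) (h : τ k = k) :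
    ∃ σ, extPerm k σ = τ := by
  refine ⟨Equiv.removeNone (((finSuccEquiv' k).symm.trans τ).trans (finSuccEquiv' k)), ?_⟩
  ext c
  simp [extPerm, map_equiv_removeNone, h]

lemma sameCycle_rel {β : Type*} (π : Equiv.Perm β) (R : β → β → Prop) (hR : Equivalence R)
    (h : ∀ c, R c (π c)) {c d : β} (hcd : π.SameCycle c d) : R c d := by
  have hn : ∀ (m : ℕ) (c : β), R c ((π ^ m) c) := by
    intro m
    induction m with
    | zero => intro c; exact hR.refl _
    | succ m ih =>
      intro c
      rw [pow_succ', Equiv.Perm.mul_apply]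
      exact hR.trans (ih c) (h _)
  obtain ⟨i, rfl⟩ := hcd
  obtain ⟨m, rfl | rfl⟩ := i.eq_nat_or_neg
  · exact hn m c
  · apply hR.symm
    have := hn m ((π ^ (-(m : ℤ))) c)
    simpa using this

lemma sameCycle_succAbove {n : ℕ} (k : Fin (n + 1)) (σ : Equiv.Perm (Fin n))
    (π : Equiv.Perm (Fin (n + 1))) (a : Fin n)
    (h1 : ∀ x, π (k.succAbove x) = k.succAbove (σ x) ∨
      (π (k.succAbove x) = k ∧ σ x = a ∧ π k = k.succAbove a))
    (h2 : π k = k ∨ π k = k.succAbove a) (x z : Fin n) :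
    π.SameCycle (k.succAbove x) (k.succAbove z) ↔ σ.SameCycle x z := by
  constructor
  · intro h
    let r : Fin (n + 1) → Fin n := fun c => (finSuccEquiv' k c).getD a
    have rk : r k = a := by simp [r]
    have re : ∀ x, r (k.succAbove x) = x := by intro x; simp [r]
    have := sameCycle_rel π (fun c d => σ.SameCycle (r c) (r d))
      ⟨fun _ => Equiv.Perm.SameCycle.refl _ _, fun h => h.symm, fun h h' => h.trans h'⟩ ?_ h
    · simpa only [re] using this
    · intro c
      rcases Fin.eq_self_or_eq_succAbove k c with rfl | ⟨w, rfl⟩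
      · rcases h2 with h2 | h2
        · rw [h2]
        · rw [h2, rk, re]
      · rcases h1 w with h | ⟨h, h', -⟩
        · rw [h, re, re]
          exact Equiv.Perm.sameCycle_apply_right.2 (Equiv.Perm.SameCycle.refl _ _)
        · rw [h, re, rk, ← h']
          exact Equiv.Perm.sameCycle_apply_right.2 (Equiv.Perm.SameCycle.refl _ _)
  · intro h
    refine sameCycle_rel σ (fun c d => π.SameCycle (k.succAbove c) (k.succAbove d))
      ⟨fun _ => Equiv.Perm.SameCycle.refl _ _, fun h => h.symm, fun h h' => h.trans h'⟩ ?_ h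
    intro w
    rcases h1 w with h | ⟨h, h', h''⟩
    · rw [← h]
      exact Equiv.Perm.sameCycle_apply_right.2 (Equiv.Perm.SameCycle.refl _ _)
    · have hw : π.SameCycle (k.succAbove w) (π (k.succAbove w)) :=
        Equiv.Perm.sameCycle_apply_right.2 (Equiv.Perm.SameCycle.refl _ _)
      rw [h] at hw
      rw [h', ← h'']
      exact Equiv.Perm.sameCycle_apply_right.2 hw

lemma cdes_ext_zero {n : ℕ} (σ : Equiv.Perm (Fin (n + 1))) :
    cdes (extPerm 0 σ) = cdes σ := by
  have hs := sameCycle_succAbove 0 σ (extPerm 0 σ) 0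
    (fun x => Or.inl (extPerm_succAbove _ _ _)) (Or.inl (extPerm_self _ _))
  have : cdesSet (extPerm 0 σ) = (cdesSet σ).map (Fin.succAboveEmb 0) := by
    ext c
    simp only [cdesSet, Finset.mem_filter, Finset.mem_univ, true_and, Finset.mem_map,
      Fin.succAboveEmb_apply]
    rcases Fin.eq_self_or_eq_succAbove 0 c with rfl | ⟨x, rfl⟩
    · constructor
      · rintro ⟨h, -⟩
        simp at h
      · rintro ⟨x, -, h⟩
        exact absurd h (Fin.succAbove_ne _ _)
    · simp only [extPerm_succAbove, Fin.succAbove_lt_succAbove_iff, Fin.succAbove_right_inj,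
        exists_eq_right]
      refine and_congr_right fun hlt => ?_
      constructor
      · rintro ⟨j, hj, hlt⟩
        rcases Fin.eq_self_or_eq_succAbove 0 j with rfl | ⟨z, rfl⟩
        · have := Equiv.Perm.SameCycle.symm hj
          have := this.eq_of_left (extPerm_self 0 σ)
          exact absurd this.symm (Fin.succAbove_ne _ _)
        · exact ⟨z, (hs _ _).1 hj, Fin.succAbove_lt_succAbove_iff.1 hlt⟩
      · rintro ⟨z, hj, hlt⟩
        exact ⟨_, (hs _ _).2 hj, Fin.succAbove_lt_succAbove_iff.2 hlt⟩
  rw [cdes, this, Finset.card_map, cdes]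

/-- Insert `k` just before `0` at the end of the cycle of `0`. -/
def insPerm {n : ℕ} (k : Fin (n + 1)) (σ : Equiv.Perm (Fin n)) : Equiv.Perm (Fin (n + 1)) :=
  Equiv.swap k 0 * extPerm k σ

lemma cdes_ins {n : ℕ} (k : Fin (n + 2)) (hk : k ≠ 0) (σ : Equiv.Perm (Fin (n + 1))) :
    cdes (insPerm k σ) = cdes σ + if (k : ℕ) ≤ (σ.symm 0 : Fin (n + 1)) then 1 else 0 := by
  have e0 : k.succAbove 0 = 0 := Fin.succAbove_ne_zero_zero hk
  have pk : insPerm k σ k = 0 := by simp [insPerm, extPerm_self]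
  have p0 : ∀ x, σ x = 0 → insPerm k σ (k.succAbove x) = k := by
    intro x hx
    simp [insPerm, extPerm_succAbove, hx, e0]
  have p1 : ∀ x, σ x ≠ 0 → insPerm k σ (k.succAbove x) = k.succAbove (σ x) := by
    intro x hx
    rw [insPerm, Equiv.Perm.mul_apply, extPerm_succAbove]
    apply Equiv.swap_apply_of_ne_of_ne (Fin.succAbove_ne _ _)
    rw [← e0]
    exact fun h => hx (Fin.succAbove_right_injective h)
  have hs := sameCycle_succAbove k σ (insPerm k σ) 0
    (fun x => by
      by_cases hx : σ x = 0
      · exact Or.inr ⟨p0 x hx, hx, by rw [pk, e0]⟩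
      · exact Or.inl (p1 x hx)) (Or.inr (by rw [pk, e0]))
  have hk0 : (insPerm k σ).SameCycle k 0 := by
    rw [← pk]
    exact Equiv.Perm.sameCycle_apply_right.2 (Equiv.Perm.SameCycle.refl _ _)
  have hlt : ∀ x : Fin (n + 1), k < k.succAbove x ↔ (k : ℕ) ≤ x := by
    intro x
    rw [Fin.lt_succAbove_iff_le_castSucc, Fin.le_def, Fin.val_castSucc]
  have : cdesSet (insPerm k σ) = (cdesSet σ ∪
      if (k : ℕ) ≤ (σ.symm 0 : Fin (n + 1)) then {σ.symm 0} else ∅).map (Fin.succAboveEmb k) := by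
    ext c
    simp only [cdesSet, Finset.mem_filter, Finset.mem_univ, true_and, Finset.mem_map,
      Fin.succAboveEmb_apply, Finset.mem_union]
    rcases Fin.eq_self_or_eq_succAbove k c with rfl | ⟨x, rfl⟩
    · constructor
      · rintro ⟨-, j, -, h⟩
        rw [pk] at h
        simp at h
      · rintro ⟨x, -, h⟩
        exact absurd h (Fin.succAbove_ne _ _)
    · simp only [Fin.succAbove_right_inj, exists_eq_right]
      by_cases hx : σ x = 0
      · have hx' : σ.symm 0 = x := by rw [← hx]; simp
        rw [p0 x hx, hlt, hx', hx]
        simp only [not_lt_zero, and_false, exists_false, false_or]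
        constructor
        · rintro ⟨h, -⟩
          simp [h]
        · intro h
          have hle : (k : ℕ) ≤ x := by
            by_contra hn
            simp [hn] at h
          refine ⟨hle, 0, ?_, Fin.pos_of_ne_zero hk⟩
          rw [← e0, hs, ← hx]
          exact Equiv.Perm.sameCycle_apply_right.2 (Equiv.Perm.SameCycle.refl _ _)
      · have hx' : x ≠ σ.symm 0 := by
          rintro rfl
          simp at hx
        have : x ∉ (if (k : ℕ) ≤ (σ.symm 0 : Fin (n + 1)) then {σ.symm 0} else ∅ :
            Finset (Fin (n + 1))) := by
          split_ifs <;> simp [hx']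
        simp only [this, or_false]
        rw [p1 x hx, Fin.succAbove_lt_succAbove_iff]
        refine and_congr_right fun _ => ?_
        constructor
        · rintro ⟨j, hj, hlt⟩
          rcases Fin.eq_self_or_eq_succAbove k j with rfl | ⟨z, rfl⟩
          · refine ⟨0, ?_, Fin.pos_of_ne_zero hx⟩
            rw [← hs, e0]
            exact hj.trans hk0
          · exact ⟨z, (hs _ _).1 hj, Fin.succAbove_lt_succAbove_iff.1 hlt⟩
        · rintro ⟨z, hj, hlt⟩
          exact ⟨_, (hs _ _).2 hj, Fin.succAbove_lt_succAbove_iff.2 hlt⟩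
  rw [cdes, this, Finset.card_map, Finset.card_union_of_disjoint, cdes]
  · split_ifs <;> simp
  · split_ifs
    · simp [cdesSet]
    · simp

lemma sum_ins {n : ℕ} (k : Fin (n + 1)) (g : Equiv.Perm (Fin (n + 1)) → ℝ) :
    ∑ π with π.symm 0 = k, g π = ∑ σ, g (insPerm k σ) := by
  symm
  refine Finset.sum_bij (fun σ _ => insPerm k σ) ?_ ?_ ?_ ?_
  · intro σ _
    simp [Equiv.symm_apply_eq, insPerm, extPerm_self]
  · intro σ _ τ _ h
    exact extPerm_injective k (mul_left_cancel h)
  · intro π hπ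
    have hπ : π k = 0 := by
      have := (Finset.mem_filter.1 hπ).2
      rw [← this]; simp
    obtain ⟨σ, hσ⟩ := extPerm_surj k (Equiv.swap k 0 * π) (by simp [hπ])
    refine ⟨σ, Finset.mem_univ _, ?_⟩
    rw [insPerm, hσ, ← mul_assoc, Equiv.swap_mul_self, one_mul]
  · intros; rfl

/-- Tail sums according to the position of the preimage of `0`. -/
noncomputable def tailSum (n k : ℕ) (y : ℝ) : ℝ :=
  ∑ π : Equiv.Perm (Fin (n + 1)) with k ≤ (π.symm 0 : Fin (n + 1)), y ^ cdes π

lemma fiber_zero (n : ℕ) (y : ℝ) :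
    ∑ π : Equiv.Perm (Fin (n + 2)) with π.symm 0 = 0, y ^ cdes π = bPoly (n + 1) y := by
  rw [sum_ins, bPoly]
  refine Finset.sum_congr rfl fun σ _ => ?_
  rw [insPerm, Equiv.swap_self, ← cdes_ext_zero σ]
  rfl

lemma fiber_pos (n : ℕ) (k : Fin (n + 2)) (hk : k ≠ 0) (y : ℝ) :
    ∑ π : Equiv.Perm (Fin (n + 2)) with π.symm 0 = k, y ^ cdes π
      = bPoly (n + 1) y + (y - 1) * tailSum n k y := by
  rw [sum_ins, bPoly, tailSum, Finset.sum_filter, Finset.mul_sum, ← Finset.sum_add_distrib]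
  refine Finset.sum_congr rfl fun σ _ => ?_
  rw [cdes_ins k hk]
  split_ifs <;> ring

lemma tailSum_succ (n : ℕ) (k : Fin (n + 1)) (y : ℝ) :
    tailSum n k y = ∑ π : Equiv.Perm (Fin (n + 1)) with π.symm 0 = k, y ^ cdes π
      + tailSum n (k + 1) y := by
  simp only [tailSum, Finset.sum_filter]
  rw [← Finset.sum_add_distrib]
  refine Finset.sum_congr rfl fun σ _ => ?_
  generalize σ.symm 0 = m
  rcases lt_trichotomy (m : ℕ) k with h | h | h
  · have h' : m ≠ k := fun e => by simp [e] at h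
    rw [if_neg (by omega), if_neg h', if_neg (by omega), add_zero]
  · rw [if_pos (by omega), if_pos (Fin.ext h), if_neg (by omega), add_zero]
  · have h' : m ≠ k := fun e => by simp [e] at h
    rw [if_pos (by omega), if_neg h', if_pos (by omega), zero_add]

lemma tailSum_top (n : ℕ) (y : ℝ) : tailSum n (n + 1) y = 0 := by
  rw [tailSum, Finset.filter_false_of_mem, Finset.sum_empty]
  intro π _
  have := (π.symm 0).isLt
  omega

lemma tailSum_closed (y : ℝ) : ∀ n l : ℕ, l ≤ n →
    tailSum n (n + 1 - l) y =
      ∑ j ∈ Finset.range n, bPoly (n - j) y * (l.choose (j + 1) : ℝ) * (y - 1) ^ j := by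
  intro n
  induction n with
  | zero =>
    intro l hl
    obtain rfl : l = 0 := by omega
    simpa using tailSum_top 0 y
  | succ n ih =>
    intro l
    induction l with
    | zero =>
      intro _
      simpa using tailSum_top (n + 1) y
    | succ l ihl =>
      intro hl
      have h1 := tailSum_succ (n + 1) ⟨n + 1 - l, by omega⟩ y
      rw [fiber_pos n _ (by rw [Ne, Fin.ext_iff]; simp; omega)] at h1
      simp only at h1
      rw [show n + 1 - l + 1 = n + 1 + 1 - l by omega, ihl (by omega), ih l (by omega)] at h1
      rw [show n + 1 + 1 - (l + 1) = n + 1 - l by omega, h1]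
      have h2 : ∀ j, bPoly (n + 1 - j) y * ((l + 1).choose (j + 1) : ℝ) * (y - 1) ^ j
          = bPoly (n + 1 - j) y * (l.choose j : ℝ) * (y - 1) ^ j
            + bPoly (n + 1 - j) y * (l.choose (j + 1) : ℝ) * (y - 1) ^ j := by
        intro j
        rw [Nat.choose_succ_succ]
        push_cast
        ring
      simp only [h2]
      rw [Finset.sum_add_distrib]
      congr 1
      rw [Finset.sum_range_succ', Finset.mul_sum, add_comm]
      congr 1
      · refine Finset.sum_congr rfl fun j _ => ?_
        rw [show n + 1 - (j + 1) = n - j by omega, pow_succ]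
        ring
      · simp

/-- b_1(y) = 1 and b_{n+1}(y) = b_n(y) + Σ_{i=1}^n b_i(y)·C(n,i−1)·(y−1)^{n−i}. -/
theorem bPoly_recurrence (y : ℝ) :
    bPoly 1 y = 1 ∧
    ∀ n : ℕ, 1 ≤ n →
      bPoly (n + 1) y =
        bPoly n y +
          ∑ i ∈ Finset.Icc 1 n,
            bPoly i y * (n.choose (i - 1) : ℝ) * (y - 1) ^ (n - i) := by
  refine ⟨?_, ?_⟩
  · have h : ∀ π : Equiv.Perm (Fin 1), cdes π = 0 := by
      intro π
      simp [cdes, cdesSet, Subsingleton.elim _ (0 : Fin 1)]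
    simp [bPoly, h]
  · intro n hn
    obtain ⟨n, rfl⟩ : ∃ m, n = m + 1 := ⟨n - 1, by omega⟩
    have h0 : bPoly (n + 1 + 1) y = tailSum (n + 1) 0 y := by
      simp [bPoly, tailSum]
    have h1 := tailSum_succ (n + 1) 0 y
    rw [fiber_zero] at h1
    have h2 := tailSum_closed y (n + 1) (n + 1) le_rfl
    rw [show n + 1 + 1 - (n + 1) = 1 by omega] at h2
    simp only [Fin.val_zero, zero_add] at h1
    rw [h0, h1, h2]
    congr 1
    refine Finset.sum_bij' (fun j _ => n + 1 - j) (fun i _ => n + 1 - i) ?_ ?_ ?_ ?_ ?_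
    · intro j hj
      simp only [Finset.mem_range, Finset.mem_Icc] at *
      omega
    · intro j hj
      simp only [Finset.mem_range, Finset.mem_Icc] at *
      omega
    · intro j hj
      simp only [Finset.mem_range] at *
      omega
    · intro j hj
      simp only [Finset.mem_Icc] at *
      omega
    · intro j hj
      simp only [Finset.mem_range] at *
      rw [show n + 1 - (n + 1 - j) = j by omega,
        Nat.choose_symm_of_eq_add (show n + 1 = (n + 1 - j - 1) + (j + 1) by omega)]
end

section
/- For n ≥ 0 define d_n(y) = Σ_{π ∈ D_n} y^{cdes(π)} for y in a commutative ring (e.g. y ∈ ℝ), where D_n is the set of derangements of [n] (so d_0(y) = 1 and d_1(y) = 0). Then for all n ≥ 1, d_{n+1}(y) = Σ_{i=0}^{n−1} C(n, i) · [ d_{i+1}(y) + d_i(y) ] · (y−1)^{n−i−1}, where C(n,k) is the binomial coefficient. -/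
open Equiv Finset

/-- d_n(y) = Σ_{π ∈ D_n} y^{cdes(π)}, the sum over derangements of [n]. -/
noncomputable def dPoly (n : ℕ) (y : ℝ) : ℝ :=
  ∑ π ∈ Finset.univ.filter (fun π : Equiv.Perm (Fin n) => ∀ j, π j ≠ j),
    y ^ cdes π

lemma sameCycle_transfer {α β : Type*} [Finite α] (σ : Perm α) (τ : Perm β) (f : α → β)
    (h : ∀ x, τ.SameCycle (f x) (f (σ x))) {x y : α} (hxy : σ.SameCycle x y) :
    τ.SameCycle (f x) (f y) := by
  obtain ⟨i, -, rfl⟩ := hxy.exists_pow_eq'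
  clear hxy
  induction i with
  | zero => exact Perm.SameCycle.refl _ _
  | succ k ih =>
    rw [pow_succ', Perm.mul_apply]
    exact ih.trans (h _)

/-- Inserting a fixed point `m ≠ 0` of `σ` at the end of the cycle of `0`. -/
lemma cdes_insert {n : ℕ} (σ : Perm (Fin (n + 1))) (m : Fin (n + 1)) (hm : σ m = m) (hm0 : m ≠ 0) :
    cdes (swap 0 m * σ) = cdes σ + if m < σ⁻¹ 0 then 1 else 0 := by
  set σ' := swap 0 m * σ with hσ'
  have e1 : ∀ x, σ x = 0 → σ' x = m := by
    intro x hx; simp [hσ', hx]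
  have e2 : σ' m = 0 := by simp [hσ', hm]
  have e3 : ∀ x, σ x ≠ 0 → x ≠ m → σ' x = σ x := by
    intro x hx hxm
    have : σ x ≠ m := fun h => hxm (σ.injective (h.trans hm.symm))
    simp [hσ', swap_apply_of_ne_of_ne hx this]
  have hst : ∀ x, σ'.SameCycle x (σ x) := by
    intro x
    by_cases hx : σ x = 0
    · refine ⟨2, ?_⟩
      rw [hx, zpow_two, Perm.mul_apply, e1 x hx, e2]
    · by_cases hxm : x = m
      · subst hxm; rw [hm]
      · rw [← e3 x hx hxm]; exact ⟨1, by simp⟩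
  have hA : ∀ x z, σ.SameCycle x z → σ'.SameCycle x z := fun x z h =>
    sameCycle_transfer σ σ' id hst h
  let f : Fin (n + 1) → Fin (n + 1) := fun x => if x = m then 0 else x
  have hf0 : f 0 = 0 := by simp [f]
  have hfm : f m = 0 := by simp [f]
  have hfne : ∀ x, x ≠ m → f x = x := by intro x hx; simp [f, hx]
  have hfle : ∀ x, f x ≤ x := by
    intro x; by_cases hx : x = m
    · subst hx; rw [hfm]; exact Fin.zero_le _
    · rw [hfne x hx]
  have hB : ∀ x z, σ'.SameCycle x z → σ.SameCycle (f x) (f z) := by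
    intro x z h
    refine sameCycle_transfer σ' σ f ?_ h
    intro x
    by_cases hxm : x = m
    · subst hxm; rw [e2, hfm, hf0]
    · rw [hfne x hxm]
      by_cases hx : σ x = 0
      · rw [e1 x hx, hfm]; exact ⟨1, by simp [hx]⟩
      · rw [e3 x hx hxm, hfne]
        · exact ⟨1, by simp⟩
        · exact fun h => hxm (σ.injective (h.trans hm.symm))
  have h0 : σ (σ⁻¹ 0) = 0 := by simp
  have key : ∀ c, c ≠ σ⁻¹ 0 → (c ∈ cdesSet σ' ↔ c ∈ cdesSet σ) := by
    intro c hc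
    have hc0 : σ c ≠ 0 := fun h => hc (by rw [← h]; simp)
    simp only [cdesSet, Finset.mem_filter, Finset.mem_univ, true_and]
    by_cases hcm : c = m
    · subst hcm
      simp [e2, hm]
    · rw [e3 c hc0 hcm]
      refine and_congr_right fun _ => ⟨?_, ?_⟩
      · rintro ⟨j, hj, hlt⟩
        refine ⟨f j, ?_, (hfle j).trans_lt hlt⟩
        simpa [hfne c hcm] using hB _ _ hj
      · rintro ⟨j, hj, hlt⟩
        exact ⟨j, hA _ _ hj, hlt⟩
  have hno : σ⁻¹ 0 ∉ cdesSet σ := by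
    simp only [cdesSet, Finset.mem_filter, Finset.mem_univ, true_and, h0]
    rintro ⟨-, j, -, hj⟩
    exact absurd hj (Fin.not_lt_zero j)
  have hiff : σ⁻¹ 0 ∈ cdesSet σ' ↔ m < σ⁻¹ 0 := by
    simp only [cdesSet, Finset.mem_filter, Finset.mem_univ, true_and, e1 _ h0]
    refine ⟨fun h => h.1, fun h => ⟨h, 0, ?_, Fin.pos_iff_ne_zero.2 hm0⟩⟩
    exact hA _ _ ⟨1, by simp⟩
  unfold cdes
  split_ifs with h
  · have : cdesSet σ' = insert (σ⁻¹ 0) (cdesSet σ) := by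
      ext c
      rw [Finset.mem_insert]
      by_cases hc : c = σ⁻¹ 0
      · subst hc; exact iff_of_true (hiff.2 h) (Or.inl rfl)
      · simp only [hc, false_or]; exact key c hc
    rw [this, Finset.card_insert_of_notMem hno]
  · have : cdesSet σ' = cdesSet σ := by
      ext c
      by_cases hc : c = σ⁻¹ 0
      · subst hc
        exact iff_of_false (fun h' => h (hiff.1 h')) hno
      · exact key c hc
    rw [this]; rfl

lemma cdes_extend {N m : ℕ} (T : Finset (Fin N)) (hT : T.card = m) (τ : Perm (Fin m)) :
    cdes (τ.extendDomain (T.orderIsoOfFin hT).toEquiv) = cdes τ := by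
  set e := (T.orderIsoOfFin hT).toEquiv with he
  have hlt : ∀ a b, ((e a : Fin N) < e b ↔ a < b) := by
    intro a b
    rw [Subtype.coe_lt_coe]; exact (T.orderIsoOfFin hT).lt_iff_lt
  symm
  unfold cdes
  refine Finset.card_bij (fun c _ => (e c : Fin N)) ?_ ?_ ?_
  · intro c hc
    simp only [cdesSet, Finset.mem_filter, Finset.mem_univ, true_and] at hc ⊢
    rw [Perm.extendDomain_apply_image, hlt]
    obtain ⟨h1, j, hj, h2⟩ := hc
    exact ⟨h1, e j, hj.extendDomain, (hlt _ _).2 h2⟩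
  · intro a _ b _ h
    exact e.injective (Subtype.ext h)
  · intro b hb
    simp only [cdesSet, Finset.mem_filter, Finset.mem_univ, true_and] at hb
    obtain ⟨h1, j, hj, h2⟩ := hb
    have hbT : b ∈ T := by
      by_contra hbT
      rw [Perm.extendDomain_apply_not_subtype _ _ hbT] at h1
      exact lt_irrefl _ h1
    have hjT : j ∈ T := by
      by_contra hjT
      have hfix : Function.IsFixedPt (τ.extendDomain e) j :=
        Perm.extendDomain_apply_not_subtype _ _ hjT
      have := hj.symm.eq_of_left hfix
      exact hjT (this ▸ hbT)
    obtain ⟨c, hc⟩ := e.surjective ⟨b, hbT⟩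
    obtain ⟨k, hk⟩ := e.surjective ⟨j, hjT⟩
    have hb' : b = e c := by rw [hc]
    have hj' : j = e k := by rw [hk]
    subst hb' hj'
    refine ⟨c, ?_, rfl⟩
    rw [Perm.extendDomain_apply_image, hlt] at h1 h2
    simp only [cdesSet, Finset.mem_filter, Finset.mem_univ, true_and]
    exact ⟨h1, k, Perm.sameCycle_extendDomain.1 hj, h2⟩

lemma sum_support {N m : ℕ} (y : ℝ) (T : Finset (Fin N)) (hT : T.card = m) :
    ∑ σ ∈ Finset.univ.filter (fun σ : Perm (Fin N) => ∀ j, σ j ≠ j ↔ j ∈ T), y ^ cdes σ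
      = dPoly m y := by
  symm
  unfold dPoly
  let e := (T.orderIsoOfFin hT).toEquiv
  refine Finset.sum_bij (fun τ _ => τ.extendDomain e) ?_ ?_ ?_ ?_
  · intro τ hτ
    simp only [Finset.mem_filter, Finset.mem_univ, true_and] at hτ ⊢
    intro j
    by_cases hj : j ∈ T
    · obtain ⟨c, hc⟩ := e.surjective ⟨j, hj⟩
      have hj' : j = e c := by rw [hc]
      subst hj'
      simp only [hj, iff_true]
      rw [Perm.extendDomain_apply_image]
      exact fun h => hτ c (e.injective (Subtype.ext h))
    · simp only [hj, iff_false, not_not]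
      exact Perm.extendDomain_apply_not_subtype _ _ hj
  · intro a _ b _ h
    ext1 x
    have := congrArg (fun g : Perm (Fin N) => g (e x)) h
    simp only [Perm.extendDomain_apply_image] at this
    exact e.injective (Subtype.ext this)
  · intro σ hσ
    simp only [Finset.mem_filter, Finset.mem_univ, true_and] at hσ
    have hp : ∀ x, σ x ∈ T ↔ x ∈ T := by
      intro x
      rw [← hσ, ← hσ]
      simp
    have happ : ∀ c, (e (e.symm.permCongr (σ.subtypePerm hp) c) : Fin N) = σ (e c) := by
      intro c; simp [Equiv.permCongr_apply]
    refine ⟨e.symm.permCongr (σ.subtypePerm hp), ?_, ?_⟩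
    · simp only [Finset.mem_filter, Finset.mem_univ, true_and]
      intro j hj
      have h2 := happ j
      rw [hj] at h2
      exact (hσ (e j)).2 (e j).2 h2.symm
    · ext1 x
      by_cases hx : x ∈ T
      · obtain ⟨c, hc⟩ := e.surjective ⟨x, hx⟩
        have hx' : x = e c := by rw [hc]
        subst hx'
        rw [Perm.extendDomain_apply_image, happ]
      · rw [Perm.extendDomain_apply_not_subtype _ _ hx]
        by_contra h
        exact hx ((hσ x).1 (Ne.symm h))
  · intro τ _
    rw [cdes_extend]

/-- Nonzero fixed points. -/
def nzFix {n : ℕ} (σ : Perm (Fin (n + 1))) : Finset (Fin (n + 1)) :=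
  Finset.univ.filter fun i => σ i = i ∧ i ≠ 0

lemma mem_nzFix {n : ℕ} (σ : Perm (Fin (n + 1))) (i) : i ∈ nzFix σ ↔ σ i = i ∧ i ≠ 0 := by
  simp [nzFix]

/-- Sum over permutations with `k` nonzero fixed points. -/
noncomputable def wSum (n k : ℕ) (y : ℝ) : ℝ :=
  ∑ σ ∈ Finset.univ.filter (fun σ : Perm (Fin (n + 1)) => (nzFix σ).card = k), y ^ cdes σ

/-- The part where the last element of the cycle of `0` exceeds all nonzero fixed points. -/
noncomputable def uSum (n k : ℕ) (y : ℝ) : ℝ :=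
  ∑ σ ∈ Finset.univ.filter (fun σ : Perm (Fin (n + 1)) =>
    (nzFix σ).card = k ∧ (nzFix σ).sup id < σ⁻¹ 0), y ^ cdes σ

lemma wSum_fiber (n : ℕ) (y : ℝ) (K : Finset (Fin (n + 1))) (hK : (0 : Fin (n + 1)) ∉ K) :
    ∑ σ ∈ Finset.univ.filter (fun σ : Perm (Fin (n + 1)) => nzFix σ = K), y ^ cdes σ
      = dPoly (n + 1 - K.card) y + dPoly (n - K.card) y := by
  have h1 : (Kᶜ).card = n + 1 - K.card := by simp [Finset.card_compl]
  have h2 : ((insert 0 K)ᶜ).card = n - K.card := by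
    rw [Finset.card_compl, Finset.card_insert_of_notMem hK, Fintype.card_fin]; omega
  rw [← sum_support y _ h1, ← sum_support y _ h2, ← Finset.sum_union]
  · refine Finset.sum_congr ?_ fun _ _ => rfl
    ext σ
    simp only [Finset.mem_union, Finset.mem_filter, Finset.mem_univ, true_and, Finset.ext_iff,
      mem_nzFix, Finset.mem_compl, Finset.mem_insert, not_or]
    constructor
    · intro h
      by_cases h0 : σ 0 = 0
      · right
        intro j
        rw [← h j]
        by_cases hj : j = 0
        · subst hj; simp [h0]
        · simp [hj]
      · left
        intro j
        rw [← h j]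
        by_cases hj : j = 0
        · subst hj; simp [h0]
        · simp [hj]
    · rintro (h | h) j
      · by_cases hj : j = 0
        · subst hj; simp [hK]
        · have := h j; tauto
      · by_cases hj : j = 0
        · subst hj; simp [hK]
        · have := h j; tauto
  · rw [Finset.disjoint_left]
    intro σ h3 h4
    simp only [Finset.mem_filter, Finset.mem_univ, true_and, Finset.mem_compl] at h3 h4
    have h5 := (h3 0).2 hK
    exact (h4 0).1 h5 (Finset.mem_insert_self _ _)

lemma wSum_eq (n k : ℕ) (y : ℝ) :
    wSum n k y = (n.choose k : ℝ) * (dPoly (n + 1 - k) y + dPoly (n - k) y) := by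
  unfold wSum
  rw [← Finset.sum_fiberwise_of_maps_to
    (t := Finset.powersetCard k (Finset.univ.erase (0 : Fin (n + 1)))) (g := nzFix)]
  · have : ∀ K ∈ Finset.powersetCard k (Finset.univ.erase (0 : Fin (n + 1))),
        ∑ σ ∈ (Finset.univ.filter (fun σ : Perm (Fin (n + 1)) => (nzFix σ).card = k)).filter
          (fun σ => nzFix σ = K), y ^ cdes σ
        = dPoly (n + 1 - k) y + dPoly (n - k) y := by
      intro K hK
      rw [Finset.mem_powersetCard] at hK
      have h0 : (0 : Fin (n + 1)) ∉ K := fun h => by simpa using hK.1 h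
      have := wSum_fiber n y K h0
      rw [hK.2] at this
      rw [← this, Finset.filter_filter]
      refine Finset.sum_congr ?_ fun _ _ => rfl
      ext σ
      simp only [Finset.mem_filter, Finset.mem_univ, true_and, and_iff_right_iff_imp]
      rintro rfl
      exact hK.2
    rw [Finset.sum_congr rfl this, Finset.sum_const, Finset.card_powersetCard]
    simp [mul_add]
  · intro σ hσ
    simp only [Finset.mem_filter, Finset.mem_univ, true_and] at hσ
    rw [Finset.mem_powersetCard]
    refine ⟨fun i hi => ?_, hσ⟩
    rw [mem_nzFix] at hi
    simp [hi.2]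

lemma nzFix_insert {n : ℕ} (σ : Perm (Fin (n + 1))) (m : Fin (n + 1)) (hm : m ∈ nzFix σ) :
    nzFix (swap 0 m * σ) = (nzFix σ).erase m := by
  rw [mem_nzFix] at hm
  ext i
  rw [Finset.mem_erase, mem_nzFix, mem_nzFix, Perm.mul_apply]
  by_cases him : i = m
  · subst him; simp [hm.1, hm.2.symm]
  · have : σ i ≠ m := fun h => him (σ.injective (h.trans hm.1.symm))
    by_cases h0 : σ i = 0
    · simp only [h0, swap_apply_left, him, ne_eq, not_false_eq_true, true_and]
      constructor
      · rintro ⟨h, _⟩; exact absurd h.symm him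
      · rintro ⟨h, h'⟩; exact absurd h.symm h'
    · rw [swap_apply_of_ne_of_ne h0 this]; simp [him]

lemma nzFix_remove {n : ℕ} (σ : Perm (Fin (n + 1))) (h : σ⁻¹ 0 ≠ 0) :
    nzFix (swap 0 (σ⁻¹ 0) * σ) = insert (σ⁻¹ 0) (nzFix σ) := by
  have h0 : σ (σ⁻¹ 0) = 0 := by simp
  generalize σ⁻¹ 0 = c at *
  ext i
  rw [Finset.mem_insert, mem_nzFix, mem_nzFix, Perm.mul_apply]
  by_cases hic : i = c
  · subst hic; simp [h0, h]
  · have h1 : σ i ≠ 0 := fun h => hic (σ.injective (h.trans h0.symm))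
    by_cases h2 : σ i = c
    · rw [h2, swap_apply_right]
      simp only [hic, false_or]
      constructor
      · rintro ⟨h, h'⟩; exact absurd h.symm h'
      · rintro ⟨h, _⟩; exact absurd h.symm hic
    · rw [swap_apply_of_ne_of_ne h1 h2]; simp [hic]

lemma sup_mem_nzFix {n : ℕ} (σ : Perm (Fin (n + 1))) (h : (nzFix σ).Nonempty) :
    (nzFix σ).sup id ∈ nzFix σ := by
  obtain ⟨i, hi, he⟩ := Finset.exists_mem_eq_sup _ h id
  rw [he]; exact hi

lemma uSum_step (n k : ℕ) (y : ℝ) :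
    uSum n k y = wSum n (k + 1) y + (y - 1) * uSum n (k + 1) y := by
  have hpos : ∀ (a b : Fin (n + 1)), a < b → b ≠ 0 := fun a b h =>
    Fin.pos_iff_ne_zero.1 ((Fin.zero_le a).trans_lt h)
  have h1 : uSum n k y = ∑ σ ∈ Finset.univ.filter
      (fun σ : Perm (Fin (n + 1)) => (nzFix σ).card = k + 1),
      y ^ cdes σ * (if (nzFix σ).sup id < σ⁻¹ 0 then y else 1) := by
    unfold uSum
    symm
    have hne : ∀ σ : Perm (Fin (n + 1)), (nzFix σ).card = k + 1 → (nzFix σ).Nonempty := by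
      intro σ h; rw [← Finset.card_pos]; omega
    refine Finset.sum_bij' (fun σ _ => swap 0 ((nzFix σ).sup id) * σ)
      (fun σ _ => swap 0 (σ⁻¹ 0) * σ) ?_ ?_ ?_ ?_ ?_
    · intro σ hσ
      simp only [Finset.mem_filter, Finset.mem_univ, true_and] at hσ ⊢
      have hm := sup_mem_nzFix σ (hne σ hσ)
      have hle : ∀ i ∈ nzFix σ, i ≤ (nzFix σ).sup id := fun i hi => Finset.le_sup (f := id) hi
      generalize (nzFix σ).sup id = m at *
      have hm' := (mem_nzFix σ m).1 hm
      rw [nzFix_insert σ m hm]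
      have hinv : (swap 0 m * σ)⁻¹ 0 = m := by
        rw [Perm.inv_eq_iff_eq]; simp [hm'.1]
      rw [hinv, Finset.card_erase_of_mem hm, hσ]
      refine ⟨rfl, ?_⟩
      rw [Finset.sup_lt_iff (Fin.pos_iff_ne_zero.2 hm'.2)]
      intro b hb
      rw [Finset.mem_erase] at hb
      exact lt_of_le_of_ne (hle b hb.2) hb.1
    · intro σ hσ
      simp only [Finset.mem_filter, Finset.mem_univ, true_and] at hσ ⊢
      have hc := hpos _ _ hσ.2
      rw [nzFix_remove σ hc, Finset.card_insert_of_notMem, hσ.1]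
      intro h
      exact absurd (Finset.le_sup (f := id) h) (not_le.2 hσ.2)
    · intro σ hσ
      simp only [Finset.mem_filter, Finset.mem_univ, true_and] at hσ
      have hm := sup_mem_nzFix σ (hne σ hσ)
      generalize (nzFix σ).sup id = m at *
      have hm' := (mem_nzFix σ m).1 hm
      have hinv : (swap 0 m * σ)⁻¹ 0 = m := by
        rw [Perm.inv_eq_iff_eq]; simp [hm'.1]
      rw [hinv, ← mul_assoc, swap_mul_self, one_mul]
    · intro σ hσ
      simp only [Finset.mem_filter, Finset.mem_univ, true_and] at hσ
      have hc := hpos _ _ hσ.2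
      have : (nzFix (swap 0 (σ⁻¹ 0) * σ)).sup id = σ⁻¹ 0 := by
        rw [nzFix_remove σ hc, Finset.sup_insert, id, sup_eq_left]
        exact hσ.2.le
      rw [this, ← mul_assoc, swap_mul_self, one_mul]
    · intro σ hσ
      simp only [Finset.mem_filter, Finset.mem_univ, true_and] at hσ
      have hm' := (mem_nzFix σ _).1 (sup_mem_nzFix σ (hne σ hσ))
      rw [cdes_insert σ _ hm'.1 hm'.2]
      split_ifs
      · rw [pow_succ]
      · simp
  rw [h1]
  unfold wSum uSum
  rw [← Finset.filter_filter, Finset.sum_filter (fun σ : Perm (Fin (n + 1)) =>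
    (nzFix σ).sup id < σ⁻¹ 0), Finset.mul_sum, ← Finset.sum_add_distrib]
  refine Finset.sum_congr rfl fun σ _ => ?_
  split_ifs <;> ring

lemma uSum_zero (n : ℕ) (y : ℝ) : uSum n 0 y = dPoly (n + 1) y := by
  unfold uSum dPoly
  refine Finset.sum_congr ?_ fun _ _ => rfl
  ext σ
  simp only [Finset.mem_filter, Finset.mem_univ, true_and, Finset.card_eq_zero]
  constructor
  · rintro ⟨h, hlt⟩ j hj
    by_cases h0 : j = 0
    · subst h0
      have : σ⁻¹ 0 = 0 := by rw [Perm.inv_eq_iff_eq, hj]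
      rw [this] at hlt
      exact absurd hlt (Fin.not_lt_zero _)
    · have : j ∈ nzFix σ := (mem_nzFix σ j).2 ⟨hj, h0⟩
      rw [h] at this
      simp at this
  · intro h
    have he : nzFix σ = ∅ := by
      ext i; simp [mem_nzFix, h i]
    refine ⟨he, ?_⟩
    rw [he, Finset.sup_empty]
    refine Fin.pos_iff_ne_zero.2 fun h' => h 0 ?_
    rw [Perm.inv_eq_iff_eq] at h'
    exact h'.symm

lemma uSum_last (n : ℕ) (y : ℝ) : uSum n n y = 0 := by
  unfold uSum
  rw [Finset.filter_false_of_mem, Finset.sum_empty]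
  rintro σ - ⟨h, hlt⟩
  have hsub : nzFix σ ⊆ Finset.univ.erase 0 := by
    intro i hi
    rw [mem_nzFix] at hi
    simp [hi.2]
  have heq : nzFix σ = Finset.univ.erase 0 := by
    refine Finset.eq_of_subset_of_card_le hsub ?_
    rw [h]; simp
  have hc : σ⁻¹ 0 ≠ 0 := Fin.pos_iff_ne_zero.1 ((Fin.zero_le _).trans_lt hlt)
  have : σ⁻¹ 0 ∈ nzFix σ := by rw [heq]; simpa using hc
  exact absurd (Finset.le_sup (f := id) this) (not_le.2 hlt)

lemma uSum_iter (n : ℕ) (y : ℝ) (m : ℕ) :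
    uSum n 0 y = ∑ k ∈ Finset.range m, wSum n (k + 1) y * (y - 1) ^ k + (y - 1) ^ m * uSum n m y := by
  induction m with
  | zero => simp
  | succ m ih => rw [ih, Finset.sum_range_succ, uSum_step n m]; ring

/-- d_{n+1}(y) = Σ_{i=0}^{n−1} C(n,i)·(d_{i+1}(y) + d_i(y))·(y−1)^{n−i−1} for n ≥ 1. -/
theorem dPoly_recurrence (y : ℝ) (n : ℕ) (hn : 1 ≤ n) :
    dPoly (n + 1) y =
      ∑ i ∈ Finset.range n,
        (n.choose i : ℝ) * (dPoly (i + 1) y + dPoly i y) * (y - 1) ^ (n - i - 1) := by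
  rw [← uSum_zero, uSum_iter n y n, uSum_last, mul_zero, add_zero, ← Finset.sum_range_reflect]
  refine Finset.sum_congr rfl fun i hi => ?_
  rw [Finset.mem_range] at hi
  have e1 : n - 1 - i + 1 = n - i := by omega
  have e2 : n + 1 - (n - i) = i + 1 := by omega
  have e3 : n - (n - i) = i := by omega
  have e4 : n - 1 - i = n - i - 1 := by omega
  rw [wSum_eq, e1, e2, e3, e4, Nat.choose_symm hi.le]
end

section
/- For n ≥ 1 let a_n = Σ_{π ∈ S_n} 2^{cdes(π)} (a natural number). Then a_1 = 1 and for all n ≥ 1, a_{n+1} = a_n + Σ_{i=1}^{n} a_{n+1−i} · C(n, i), where C(n,k) is the binomial coefficient (Klazar's recurrence). -/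
open Equiv Finset

/-- a_n = Σ_{π ∈ S_n} 2^{cdes(π)}. -/
def klazarA (n : ℕ) : ℕ :=
  ∑ π : Equiv.Perm (Fin n), 2 ^ cdes π


namespace KlazarAux

open Polynomial

/-- Extend a permutation of `Fin n` to `Fin (n+1)` fixing the last element. -/
def ext {n : ℕ} (σ : Equiv.Perm (Fin n)) : Equiv.Perm (Fin (n + 1)) :=
  finSuccEquivLast.symm.permCongr (Equiv.optionCongr σ)

theorem ext_castSucc {n : ℕ} (σ : Equiv.Perm (Fin n)) (a : Fin n) :
    ext σ a.castSucc = (σ a).castSucc := by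
  simp [ext, Equiv.permCongr_apply]

theorem ext_last {n : ℕ} (σ : Equiv.Perm (Fin n)) :
    ext σ (Fin.last n) = Fin.last n := by
  simp [ext, Equiv.permCongr_apply]

theorem ext_injective {n : ℕ} : Function.Injective (ext (n := n)) := by
  intro σ τ h
  ext a
  have := congrArg (fun p => p a.castSucc) h
  simp only [ext_castSucc] at this
  exact congrArg Fin.val (Fin.castSucc_injective _ this)

/-- Insert the maximum after `x`. -/
def ins {n : ℕ} (x : Fin (n + 1)) (σ : Equiv.Perm (Fin n)) : Equiv.Perm (Fin (n + 1)) :=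
  ext σ * Equiv.swap (Fin.last n) x

theorem ins_self {n : ℕ} (x : Fin (n + 1)) (σ : Equiv.Perm (Fin n)) :
    ins x σ x = Fin.last n := by
  simp [ins, ext_last]

theorem ins_bij (n : ℕ) :
    Function.Bijective (fun p : Equiv.Perm (Fin n) × Fin (n + 1) => ins p.2 p.1) := by
  rw [Fintype.bijective_iff_injective_and_card]
  constructor
  · rintro ⟨σ, x⟩ ⟨τ, y⟩ h
    simp only at h
    have hx : x = y := by
      apply (ins y τ).injective
      rw [ins_self, ← h, ins_self]
    subst hx
    have := mul_right_cancel h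
    rw [ext_injective this]
  · simp [Fintype.card_perm, Nat.factorial_succ, mul_comm]

theorem sum_perm {M : Type*} [AddCommMonoid M] (n : ℕ) (f : Equiv.Perm (Fin (n + 1)) → M) :
    ∑ π, f π = ∑ σ : Equiv.Perm (Fin n),
      ((∑ c : Fin n, f (ins c.castSucc σ)) + f (ins (Fin.last n) σ)) := by
  rw [← (ins_bij n).sum_comp f, Fintype.sum_prod_type]
  refine Finset.sum_congr rfl fun σ _ => ?_
  rw [Fin.sum_univ_castSucc]

theorem sameCycle_map {α β : Type*} {π : Equiv.Perm α} {σ : Equiv.Perm β} (f : α → β)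
    (h : ∀ x, σ.SameCycle (f x) (f (π x))) {x y : α} (hxy : π.SameCycle x y) :
    σ.SameCycle (f x) (f y) := by
  obtain ⟨k, rfl⟩ := hxy
  induction k using Int.induction_on with
  | zero => simpa using Equiv.Perm.SameCycle.refl _ _
  | succ k ih =>
    rw [add_comm, zpow_add, zpow_one, Equiv.Perm.mul_apply]
    exact ih.trans (h _)
  | pred k ih =>
    have := h ((π ^ (-(k : ℤ) - 1)) x)
    rw [← Equiv.Perm.mul_apply, ← zpow_one_add] at this
    rw [show (1 : ℤ) + (-(k : ℤ) - 1) = -k by ring] at this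
    exact ih.trans this.symm

section insertion
variable {n : ℕ} (σ : Equiv.Perm (Fin n)) (c : Fin n)

theorem ins_castSucc_of_ne {a : Fin n} (h : a ≠ c) :
    ins c.castSucc σ a.castSucc = (σ a).castSucc := by
  have h1 : a.castSucc ≠ Fin.last n := Fin.castSucc_ne_last a
  have h2 : a.castSucc ≠ c.castSucc := fun e => h (Fin.castSucc_injective _ e)
  simp [ins, Equiv.swap_apply_of_ne_of_ne h1 h2, ext_castSucc]

theorem ins_last : ins c.castSucc σ (Fin.last n) = (σ c).castSucc := by
  simp [ins, ext_castSucc]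

theorem ins_fix (a : Fin n) : ins (Fin.last n) σ a.castSucc = (σ a).castSucc := by
  simp [ins, ext_castSucc]

theorem same_ins (a b : Fin n) :
    (ins c.castSucc σ).SameCycle a.castSucc b.castSucc ↔ σ.SameCycle a b := by
  constructor
  · intro h
    have := sameCycle_map (σ := σ) (fun x : Fin (n + 1) => Fin.lastCases (motive := fun _ => Fin n)
      c (fun i => i) x) ?_ h
    · simpa using this
    · intro x
      induction x using Fin.lastCases with
      | last => simp [ins_last, Equiv.Perm.SameCycle.refl]
      | cast i =>
        by_cases hi : i = c
        · subst hi; simp [ins_self, Equiv.Perm.SameCycle.refl]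
        · simp [ins_castSucc_of_ne σ c hi, Equiv.Perm.SameCycle.refl]
  · intro h
    refine sameCycle_map (fun x : Fin n => x.castSucc) ?_ h
    intro x
    by_cases hx : x = c
    · subst hx
      refine ⟨2, ?_⟩
      rw [show (2 : ℤ) = 1 + 1 by norm_num, zpow_add, zpow_one, Equiv.Perm.mul_apply, ins_self,
        ins_last]
    · exact ⟨1, by rw [zpow_one, ins_castSucc_of_ne σ c hx]⟩

theorem same_ins_last (b : Fin n) :
    (ins c.castSucc σ).SameCycle (Fin.last n) b.castSucc ↔ σ.SameCycle c b := by
  rw [← same_ins σ c]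
  have h : (ins c.castSucc σ).SameCycle c.castSucc (Fin.last n) :=
    ⟨1, by rw [zpow_one, ins_self]⟩
  exact ⟨fun k => h.trans k, fun k => h.symm.trans k⟩

theorem same_fix (a b : Fin n) :
    (ins (Fin.last n) σ).SameCycle a.castSucc b.castSucc ↔ σ.SameCycle a b := by
  constructor
  · intro h
    have := sameCycle_map (σ := σ) (fun x : Fin (n + 1) => Fin.lastCases (motive := fun _ => Fin n)
      a (fun i => i) x) ?_ h
    · simpa using this
    · intro x
      induction x using Fin.lastCases with
      | last => simp [ins_self, Equiv.Perm.SameCycle.refl]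
      | cast i => simp [ins_fix, Equiv.Perm.SameCycle.refl]
  · intro h
    refine sameCycle_map (fun x : Fin n => x.castSucc) ?_ h
    exact fun x => ⟨1, by rw [zpow_one, ins_fix σ]⟩

theorem same_fix_last (b : Fin n) :
    ¬ (ins (Fin.last n) σ).SameCycle (Fin.last n) b.castSucc := by
  intro h
  have := (Equiv.Perm.SameCycle.eq_of_left h (ins_self _ σ))
  exact Fin.castSucc_ne_last b this.symm

open Classical in
theorem cyc_ins : cyc (ins c.castSucc σ) = cyc σ := by
  simp only [cyc, Finset.card_filter]
  rw [Fin.sum_univ_castSucc, if_neg, add_zero]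
  · refine Finset.sum_congr rfl fun a _ => ?_
    simp only [Fin.forall_fin_succ', same_ins, Fin.castSucc_le_castSucc_iff]
    simp [Fin.le_last]
  · intro h
    have := h c.castSucc ((same_ins_last σ c c).2 (Equiv.Perm.SameCycle.refl _ _))
    exact absurd (Fin.castSucc_lt_last c) (not_lt.2 this)

theorem cyc_fix : cyc (ins (Fin.last n) σ) = cyc σ + 1 := by
  simp only [cyc, Finset.card_filter]
  rw [Fin.sum_univ_castSucc, if_pos]
  · congr 1
    refine Finset.sum_congr rfl fun a _ => ?_
    simp only [Fin.forall_fin_succ', same_fix, Fin.castSucc_le_castSucc_iff]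
    simp [Fin.le_last]
  · intro j
    induction j using Fin.lastCases with
    | last => simp
    | cast i => intro h; exact absurd h (same_fix_last σ i)

theorem cdes_fix : cdes (ins (Fin.last n) σ) = cdes σ := by
  simp only [cdes, cdesSet, Finset.card_filter]
  rw [Fin.sum_univ_castSucc, if_neg, add_zero]
  · refine Finset.sum_congr rfl fun a _ => ?_
    simp only [Fin.exists_fin_succ', same_fix, ins_fix, Fin.castSucc_lt_castSucc_iff]
    simp [not_lt.2 (Fin.le_last _)]
  · simp [ins_self]

/-- The neutral positions. -/
def Neutral (c : Fin n) : Prop := c ∈ cdesSet σ ∨ ∀ j, σ.SameCycle (σ c) j → σ c ≤ j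

open Classical in
theorem cdes_ins : cdes (ins c.castSucc σ) = cdes σ + if Neutral σ c then 0 else 1 := by
  have h1 : cdes (ins c.castSucc σ) = ((cdesSet σ).erase c).card +
      if (∀ j, σ.SameCycle (σ c) j → σ c ≤ j) then 0 else 1 := by
    rw [show (cdesSet σ).erase c = Finset.univ.filter (fun a => a ∈ (cdesSet σ).erase c) by ext; simp]
    rw [cdes, cdesSet, Finset.card_filter, Finset.card_filter, Fin.sum_univ_castSucc]
    congr 1
    · refine Finset.sum_congr rfl fun a _ => if_congr ?_ rfl rfl
      by_cases ha : a = c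
      · subst ha; simp [ins_self, not_lt.2 (Fin.le_last _)]
      · simp [ha, cdesSet, Fin.exists_fin_succ', same_ins, ins_castSucc_of_ne σ c ha,
          not_lt.2 (Fin.le_last _)]
    · have : (ins c.castSucc σ (Fin.last n) < Fin.last n ∧
          ∃ j, (ins c.castSucc σ).SameCycle (Fin.last n) j ∧ j < ins c.castSucc σ (Fin.last n)) ↔
          ¬ (∀ j, σ.SameCycle (σ c) j → σ c ≤ j) := by
        simp [Fin.exists_fin_succ', same_ins_last, ins_last, Fin.castSucc_lt_last,
          not_lt.2 (Fin.le_last _)]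
      rw [if_congr this rfl rfl, ite_not]
  rw [h1, cdes]
  by_cases hc : c ∈ cdesSet σ
  · have h2 : ¬ (∀ j, σ.SameCycle (σ c) j → σ c ≤ j) := by
      simp only [cdesSet, Finset.mem_filter] at hc
      obtain ⟨-, -, j, hj, hlt⟩ := hc
      intro h
      exact absurd hlt (not_lt.2 (h j (Equiv.Perm.sameCycle_apply_left.2 hj)))
    rw [if_neg h2, if_pos (show Neutral σ c from Or.inl hc), Finset.card_erase_add_one hc, add_zero]
  · rw [Finset.erase_eq_of_notMem hc]
    simp [Neutral, hc]

open Classical in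
theorem card_neutral : (Finset.univ.filter (Neutral σ)).card = cyc σ + cdes σ := by
  have : cyc σ = (Finset.univ.filter (fun c => ∀ j, σ.SameCycle (σ c) j → σ c ≤ j)).card := by
    simp only [cyc, Finset.card_filter]
    rw [← Equiv.sum_comp σ]
  rw [this, cdes, ← Finset.card_union_of_disjoint]
  · congr 1
    ext a
    simp [Neutral, or_comm]
  · rw [Finset.disjoint_left]
    intro a ha hc
    simp only [cdesSet, Finset.mem_filter, Finset.mem_univ, true_and] at ha hc
    obtain ⟨-, j, hj, hlt⟩ := hc
    exact absurd hlt (not_lt.2 (ha j (Equiv.Perm.sameCycle_apply_left.2 hj)))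

end insertion

/-- The weight of a permutation. -/
noncomputable def wt {n : ℕ} (σ : Equiv.Perm (Fin n)) : ℤ[X] :=
  2 ^ cdes σ * X ^ (cyc σ + cdes σ)

/-- The refined generating polynomial. -/
noncomputable def Q (n : ℕ) : ℤ[X] := ∑ σ : Equiv.Perm (Fin n), wt σ

theorem wt_deriv {n : ℕ} (σ : Equiv.Perm (Fin n)) :
    X * derivative (wt σ) = ((cyc σ + cdes σ : ℕ) : ℤ[X]) * wt σ := by
  have h2 : derivative ((2 : ℤ[X]) ^ cdes σ) = 0 := by
    rw [show (2 : ℤ[X]) ^ cdes σ = C ((2 : ℤ) ^ cdes σ) by simp, derivative_C]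
  rw [wt, derivative_mul, h2, derivative_X_pow]
  rcases Nat.eq_zero_or_pos (cyc σ + cdes σ) with h | h
  · simp [h]
  · obtain ⟨k, hk⟩ := Nat.exists_eq_succ_of_ne_zero h.ne'
    rw [hk]
    simp [pow_succ]
    ring

open Classical in
theorem sum_wt_ins {n : ℕ} (σ : Equiv.Perm (Fin n)) :
    ∑ c : Fin n, wt (ins c.castSucc σ) =
      2 * (n : ℤ[X]) * X * wt σ + (1 - 2 * X) * (X * derivative (wt σ)) := by
  have h : ∀ c : Fin n, wt (ins c.castSucc σ) =
      2 * X * wt σ + if Neutral σ c then (1 - 2 * X) * wt σ else 0 := by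
    intro c
    rw [wt, cyc_ins, cdes_ins, wt]
    split_ifs
    · simp; ring
    · ring
  rw [Finset.sum_congr rfl fun c _ => h c, Finset.sum_add_distrib, ← Finset.sum_filter,
    Finset.sum_const, Finset.sum_const, card_neutral, wt_deriv]
  simp
  ring

theorem wt_fix {n : ℕ} (σ : Equiv.Perm (Fin n)) :
    wt (ins (Fin.last n) σ) = X * wt σ := by
  rw [wt, cyc_fix, cdes_fix, wt]
  ring

theorem Q_succ (n : ℕ) :
    Q (n + 1) = (1 + 2 * (n : ℤ[X])) * X * Q n + (1 - 2 * X) * X * derivative (Q n) := by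
  rw [Q, sum_perm, Q, derivative_sum, Finset.mul_sum, Finset.mul_sum, ← Finset.sum_add_distrib]
  refine Finset.sum_congr rfl fun σ _ => ?_
  rw [sum_wt_ins, wt_fix]
  ring

theorem deriv_term (n i : ℕ) (hi : i ≤ n) (k : ℕ) :
    (1 - 2 * X) * X * derivative ((2 * X - 1) ^ i * (k : ℤ[X]) * Q (n - i)) =
      (2 * X - 1) ^ i * (k : ℤ[X]) * Q (n + 1 - i)
      - (1 + 2 * (n : ℤ[X])) * X * ((2 * X - 1) ^ i * (k : ℤ[X]) * Q (n - i)) := by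
  obtain ⟨m, rfl⟩ := Nat.exists_eq_add_of_le hi
  rw [show i + m - i = m by omega, show i + m + 1 - i = m + 1 by omega, Q_succ]
  rcases i with _ | i
  · simp
    ring
  · simp [derivative_mul, derivative_pow]
    ring

theorem pascal_sum (P : ℕ → ℤ[X]) (n : ℕ) (e : P (n + 1) - X * P n =
    ∑ i ∈ Finset.range n, (2 * X - 1) ^ i * (n.choose (i + 1) : ℤ[X]) * P (n - i)) :
    ∑ i ∈ Finset.range (n + 1),
          (2 * X - 1) ^ i * ((n + 1).choose (i + 1) : ℤ[X]) * P (n + 1 - i) =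
        ∑ i ∈ Finset.range n, (2 * X - 1) ^ i * (n.choose (i + 1) : ℤ[X]) * P (n + 1 - i)
        + (P (n + 1) + (2 * X - 1) * (P (n + 1) - X * P n)) := by
  have e1 : ∑ i ∈ Finset.range (n + 1),
      (2 * X - 1) ^ i * (n.choose i : ℤ[X]) * P (n + 1 - i) =
      P (n + 1) + (2 * X - 1) * (P (n + 1) - X * P n) := by
    rw [Finset.sum_range_succ', e, Finset.mul_sum, add_comm]
    congr 1
    · simp
    · refine Finset.sum_congr rfl fun i _ => ?_
      rw [Nat.add_sub_add_right]
      ring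
  have e2 : ∑ i ∈ Finset.range (n + 1),
      (2 * X - 1) ^ i * (n.choose (i + 1) : ℤ[X]) * P (n + 1 - i) =
      ∑ i ∈ Finset.range n,
      (2 * X - 1) ^ i * (n.choose (i + 1) : ℤ[X]) * P (n + 1 - i) := by
    rw [Finset.sum_range_succ]
    simp
  rw [← e1, ← e2, ← Finset.sum_add_distrib]
  refine Finset.sum_congr rfl fun i _ => ?_
  rw [Nat.choose_succ_succ]
  push_cast
  ring

theorem Q_rec (n : ℕ) : Q (n + 1) = X * Q n +
    ∑ i ∈ Finset.range n, (2 * X - 1) ^ i * (n.choose (i + 1) : ℤ[X]) * Q (n - i) := by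
  induction n with
  | zero =>
    rw [Q_succ]
    have : derivative (Q 0) = 0 := by
      simp [Q, wt, cyc, cdes, cdesSet]
    simp [this]
  | succ n ih =>
    have hd : (1 - 2 * X) * X * derivative (Q (n + 1)) =
        (1 - 2 * X) * X * Q n + X * (Q (n + 1) - (1 + 2 * (n : ℤ[X])) * X * Q n) +
        (∑ i ∈ Finset.range n, (2 * X - 1) ^ i * (n.choose (i + 1) : ℤ[X]) * Q (n + 1 - i)
        - (1 + 2 * (n : ℤ[X])) * X * (Q (n + 1) - X * Q n)) := by
      have e : Q (n + 1) - X * Q n =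
        ∑ i ∈ Finset.range n, (2 * X - 1) ^ i * (n.choose (i + 1) : ℤ[X]) * Q (n - i) := by
        rw [ih]; ring
      rw [e, Finset.mul_sum, ← Finset.sum_sub_distrib,
        ← Finset.sum_congr rfl fun i hi => deriv_term n i (Finset.mem_range.1 hi).le _,
        ← Finset.mul_sum, ← derivative_sum, ← e, Q_succ n]
      simp only [derivative_sub, derivative_mul, derivative_X]
      ring
    have hs := pascal_sum Q n (by rw [ih]; ring)
    rw [hs, Q_succ (n + 1), hd]
    push_cast
    ring

theorem Q_eval (n : ℕ) : (Q n).eval 1 = (klazarA n : ℤ) := by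
  simp [Q, wt, klazarA, eval_finsetSum]

end KlazarAux

/-- Klazar's recurrence: a_1 = 1 and a_{n+1} = a_n + Σ_{i=1}^n a_{n+1−i}·C(n,i). -/
theorem klazarA_recurrence :
    klazarA 1 = 1 ∧
    ∀ n : ℕ, 1 ≤ n →
      klazarA (n + 1) =
        klazarA n + ∑ i ∈ Finset.Icc 1 n, klazarA (n + 1 - i) * n.choose i := by
  constructor
  · simp [klazarA, cdes, cdesSet]
  · intro n _
    have h := congrArg (Polynomial.eval 1) (KlazarAux.Q_rec n)
    simp only [Polynomial.eval_add, Polynomial.eval_mul, Polynomial.eval_X, one_mul,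
      Polynomial.eval_finsetSum, KlazarAux.Q_eval] at h
    zify
    rw [h, ← Finset.Ico_add_one_right_eq_Icc, Finset.sum_Ico_eq_sum_range]
    congr 1
    refine Finset.sum_congr rfl fun i hi => ?_
    rw [show n + 1 - (1 + i) = n - i by omega, add_comm 1 i]
    simp

    ring
end

section
/- Let n ≥ 2 and let t be an element of a commutative ring (e.g. t ∈ ℝ). Then Σ_{π ∈ S_n} (−1)^{cdes(π)} t^{π^{-1}(1)} = 2^{n−2} (t + t^n), where π^{-1}(1) is the position of 1 in π, i.e. the index i with π(i) = 1. -/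
open Equiv Finset

/-- Test matrix: row zero arbitrary, other rows `-1` left of the diagonal and `1` elsewhere. -/
def sgnMat (m : ℕ) (v : Fin (m + 1) → ℝ) : Matrix (Fin (m + 1)) (Fin (m + 1)) ℝ :=
  fun d c => if d = 0 then v c else if c < d then -1 else 1

theorem sgnMat_det_succ (m : ℕ) (v : Fin (m + 2) → ℝ) :
    (sgnMat (m + 1) v).det = (v 0 + v (Fin.last _)) * (sgnMat m (fun _ => 1)).det := by
  have h0 : (0 : Fin (m + 2)) ≠ Fin.last (m + 1) := by
    simp [Fin.ext_iff]
  rw [← Matrix.det_updateCol_add_self (sgnMat (m + 1) v) h0, Matrix.det_succ_column_zero,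
    Fin.sum_univ_succ, Finset.sum_eq_zero]
  · simp only [Matrix.updateCol_self, add_zero]
    have : ((sgnMat (m + 1) v).updateCol 0 fun k => sgnMat (m + 1) v k 0 +
        sgnMat (m + 1) v k (Fin.last (m + 1))).submatrix (Fin.succAbove 0) Fin.succ
        = sgnMat m (fun _ => 1) := by
      ext i j
      simp only [Matrix.submatrix_apply, Fin.zero_succAbove,
        Matrix.updateCol_ne (Fin.succ_ne_zero j)]
      simp only [sgnMat, Fin.succ_ne_zero, if_false, Fin.succ_lt_succ_iff]
      by_cases hi : i = 0
      · subst hi; simp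
      · simp [hi]
    rw [this]
    simp [sgnMat]
  · intro i _
    have : ¬ (Fin.last (m + 1) < i.succ) := not_lt.mpr (Fin.le_last _)
    simp [sgnMat, this]

theorem sgnMat_det_one (m : ℕ) : (sgnMat m (fun _ => 1)).det = 2 ^ m := by
  induction m with
  | zero => simp [sgnMat]
  | succ m ih => rw [sgnMat_det_succ, ih]; ring

theorem cyc_eq {n : ℕ} (π : Equiv.Perm (Fin n)) :
    cyc π + π.support.card = n + π.cycleType.card := by
  classical
  have h1 : cyc π = (univ.filter fun c : Fin n => (∀ j, π.SameCycle c j → c ≤ j) ∧ π c ≠ c).card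
      + (univ.filter fun c : Fin n => π c = c).card := by
    unfold cyc
    rw [← Finset.card_filter_add_card_filter_not (fun c => π c ≠ c), Finset.filter_filter,
      Finset.filter_filter]
    congr 2
    ext c
    simp only [mem_filter, mem_univ, true_and, not_not, and_iff_right_iff_imp]
    intro hc j hj
    obtain ⟨k, rfl⟩ := hj
    rw [Equiv.Perm.zpow_apply_eq_self_of_apply_eq_self hc]
  have h2 : (univ.filter fun c : Fin n => π c = c).card + π.support.card = n := by
    have := Finset.card_filter_add_card_filter_not (s := (univ : Finset (Fin n))) (fun c => π c = c)
    simpa [Equiv.Perm.support] using this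
  have h3 : (univ.filter fun c : Fin n => (∀ j, π.SameCycle c j → c ≤ j) ∧ π c ≠ c).card
      = π.cycleType.card := by
    rw [Equiv.Perm.cycleType_def, Multiset.card_map]
    change _ = π.cycleFactorsFinset.card
    apply Finset.card_bij (fun c _ => π.cycleOf c)
    · intro c hc
      simp only [mem_filter, mem_univ, true_and] at hc
      rw [Equiv.Perm.cycleOf_mem_cycleFactorsFinset_iff, Equiv.Perm.mem_support]
      exact hc.2
    · intro c hc d hd h
      simp only [mem_filter, mem_univ, true_and] at hc hd
      have hs : π.SameCycle c d := by
        have h4 : c ∈ (π.cycleOf d).support := by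
          rw [← h, Equiv.Perm.mem_support_cycleOf_iff]
          exact ⟨Equiv.Perm.SameCycle.refl _ _, Equiv.Perm.mem_support.2 hc.2⟩
        exact ((Equiv.Perm.mem_support_cycleOf_iff.1 h4).1).symm
      exact le_antisymm (hc.1 d hs) (hd.1 c hs.symm)
    · intro g hg
      have hne : g.support.Nonempty := by
        have := (Equiv.Perm.mem_cycleFactorsFinset_iff.1 hg).1
        rw [Finset.nonempty_iff_ne_empty, ne_eq, Equiv.Perm.support_eq_empty_iff]
        exact this.ne_one
      have hm := Finset.min'_mem _ hne
      have hc := Equiv.Perm.cycle_is_cycleOf hm hg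
      refine ⟨g.support.min' hne, ?_, hc.symm⟩
      have hms : π (g.support.min' hne) ≠ g.support.min' hne :=
        Equiv.Perm.mem_support.1 (Equiv.Perm.mem_cycleFactorsFinset_support_le hg hm)
      simp only [mem_filter, mem_univ, true_and]
      refine ⟨fun j hj => Finset.min'_le _ _ ?_, hms⟩
      rw [hc, Equiv.Perm.mem_support_cycleOf_iff]
      exact ⟨hj, Equiv.Perm.mem_support.2 hms⟩
  omega

theorem cdes_add {n : ℕ} (π : Equiv.Perm (Fin n)) : cdes π + cyc π + exc π = n := by
  classical
  have h1 : cyc π = (univ.filter fun c : Fin n => ∀ j, π.SameCycle c j → π c ≤ j).card := by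
    unfold cyc
    symm
    apply Finset.card_bij (fun c _ => π c)
    · intro c hc
      simp only [mem_filter, mem_univ, true_and] at hc ⊢
      intro j hj
      exact hc j (Equiv.Perm.sameCycle_apply_left.1 hj)
    · intro a _ b _ h
      exact π.injective h
    · intro c hc
      simp only [mem_filter, mem_univ, true_and] at hc
      refine ⟨π.symm c, ?_, by simp⟩
      simp only [mem_filter, mem_univ, true_and]
      intro j hj
      have := Equiv.Perm.sameCycle_apply_left.2 hj
      simp only [Equiv.apply_symm_apply] at this ⊢
      exact hc j this
  rw [h1]
  unfold cdes cdesSet exc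
  rw [← Finset.card_union_of_disjoint, ← Finset.card_union_of_disjoint]
  · convert Finset.card_fin n
    ext c
    simp only [mem_union, mem_filter, mem_univ, true_and, iff_true]
    by_cases h : ∀ j, π.SameCycle c j → π c ≤ j
    · exact Or.inl (Or.inr h)
    · push Not at h
      rcases lt_trichotomy c (π c) with h2 | h2 | h2
      · exact Or.inr h2
      · exfalso
        obtain ⟨j, hj, hlt⟩ := h
        obtain ⟨k, rfl⟩ := hj
        rw [Equiv.Perm.zpow_apply_eq_self_of_apply_eq_self h2.symm, ← h2] at hlt
        exact lt_irrefl _ hlt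
      · exact Or.inl (Or.inl ⟨h2, h⟩)
  · rw [Finset.disjoint_left]
    intro c hc hd
    simp only [mem_union, mem_filter, mem_univ, true_and] at hc hd
    rcases hc with hc | hc
    · exact lt_asymm hc.1 hd
    · exact absurd (hc c (Equiv.Perm.SameCycle.refl _ _)) (not_le.2 hd)
  · rw [Finset.disjoint_left]
    intro c hc hd
    simp only [mem_filter, mem_univ, true_and] at hc hd
    obtain ⟨j, hj, hlt⟩ := hc.2
    exact absurd (hd j hj) (not_le.2 hlt)

theorem neg_one_pow_cdes {n : ℕ} (π : Equiv.Perm (Fin n)) :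
    (-1 : ℝ) ^ cdes π = ((Equiv.Perm.sign π : ℤ) : ℝ) * (-1) ^ exc π := by
  have h1 := cyc_eq π
  have h2 := cdes_add π
  rw [Equiv.Perm.sign_of_cycleType, Equiv.Perm.sum_cycleType]
  push_cast
  rw [← pow_add, neg_one_pow_eq_pow_mod_two, neg_one_pow_eq_pow_mod_two (n := _ + _ + _)]
  congr 1
  omega

/-- Σ_{π ∈ S_n} (−1)^{cdes(π)} t^{π⁻¹(1)} = 2^{n−2}(t + t^n) for n ≥ 2.
(π⁻¹(1), the position of 1 in π, is encoded as (π.symm 0).val + 1.) -/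
theorem signed_cdes_position_enumerator (n : ℕ) (hn : 2 ≤ n) (t : ℝ) :
    (∑ π : Equiv.Perm (Fin n),
        (-1 : ℝ) ^ cdes π * t ^ ((π.symm ⟨0, by omega⟩).val + 1)) =
      2 ^ (n - 2) * (t + t ^ n) := by
  obtain ⟨m, rfl⟩ : ∃ m, n = m + 2 := ⟨n - 2, by omega⟩
  have key := sgnMat_det_succ m (fun c => t ^ (c.val + 1))
  rw [sgnMat_det_one, Matrix.det_apply'] at key
  have : ∀ π : Equiv.Perm (Fin (m + 2)),
      (-1 : ℝ) ^ cdes π * t ^ ((π.symm ⟨0, by omega⟩).val + 1) =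
      ((Equiv.Perm.sign π : ℤ) : ℝ) *
        ∏ i, sgnMat (m + 1) (fun c => t ^ (c.val + 1)) (π i) i := by
    intro π
    rw [neg_one_pow_cdes, mul_assoc]
    congr 1
    have e : ∀ i, sgnMat (m + 1) (fun c => t ^ (c.val + 1)) (π i) i =
        (if i < π i then (-1 : ℝ) else 1) *
          (if i = π.symm 0 then t ^ (i.val + 1) else 1) := by
      intro i
      have hi : i = π.symm 0 ↔ π i = 0 := by rw [Equiv.eq_symm_apply]
      simp only [hi, sgnMat]
      by_cases h : π i = 0 <;> simp [h]
    simp only [e]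
    rw [Finset.prod_mul_distrib, Finset.prod_ite_eq' , Finset.prod_ite]
    simp [exc]
  rw [Finset.sum_congr rfl (fun π _ => this π), key]
  simp
  ring
end

section
/- For every n ≥ 1 there exists a bijection Θ from the set of cyclic negative cycle descent permutations of [n] (those negative cycle descent permutations (π, φ) for which π has exactly one cycle, i.e. cyc(π) = 1) to the set of connected Callan perfect matchings of P_n = [n] × {0,1}. -/
open Equiv Finset

/-- A negative cycle descent permutation: a permutation together with a sign map
(φ c = true means c has sign −1) whose negative entries are all cycle descents. -/
def IsNCD {n : ℕ} (p : Equiv.Perm (Fin n) × (Fin n → Bool)) : Prop :=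
  ∀ c, p.2 c = true → c ∈ cdesSet p.1

/-- neg(π,φ): the number of entries with sign −1. -/
def negCount {n : ℕ} (p : Equiv.Perm (Fin n) × (Fin n → Bool)) : ℕ :=
  (Finset.univ.filter fun c => p.2 c = true).card

/-- A perfect matching of P_n = [n] × {0,1}: a fixed-point-free involution of
Fin n × Bool (row 0 is false, row 1 is true). -/
def IsPM {n : ℕ} (M : Equiv.Perm (Fin n × Bool)) : Prop :=
  M * M = 1 ∧ ∀ v, M v ≠ v

/-- A Callan perfect matching: a perfect matching with no uplines, i.e. no edge
joins (i,0) to (j,1) with i < j. -/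
def IsCallan {n : ℕ} (M : Equiv.Perm (Fin n × Bool)) : Prop :=
  IsPM M ∧ ∀ i j : Fin n, M (i, false) = (j, true) → ¬ i < j

/-- The number of downlines: edges joining (i,0) to (j,1) with i > j. -/
def downCount {n : ℕ} (M : Equiv.Perm (Fin n × Bool)) : ℕ :=
  (Finset.univ.filter fun i : Fin n => ∃ j : Fin n, j < i ∧ M (i, false) = (j, true)).card

/-- The number of vertical lines: edges joining (i,0) to (i,1). -/
def verCount {n : ℕ} (M : Equiv.Perm (Fin n × Bool)) : ℕ :=
  (Finset.univ.filter fun i : Fin n => M (i, false) = (i, true)).card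

/-- The graph G(M) on [n]: distinct i, j are adjacent iff M matches a vertex of
column i with a vertex of column j. -/
def matchGraph {n : ℕ} (M : Equiv.Perm (Fin n × Bool)) : SimpleGraph (Fin n) :=
  SimpleGraph.fromRel fun i j => ∃ a b : Bool, M (i, a) = (j, b)

/-- com(M): the number of connected components of G(M). -/
noncomputable def comCount {n : ℕ} (M : Equiv.Perm (Fin n × Bool)) : ℕ :=
  Nat.card (matchGraph M).ConnectedComponent

namespace NCDProof

/-- left end of the block of `k` -/
noncomputable def lft (s : ℕ → Prop) : ℕ → ℕ
  | 0 => 0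
  | k + 1 => open Classical in if s k then lft s k else k + 1

lemma rho_nat (s : ℕ → Prop) (m : ℕ) (hm : ∀ k, m ≤ k → ¬ s k) :
    ∃ ρ : ℕ → ℕ, (∀ k, ρ (ρ k) = k) ∧ (∀ k, k ≤ m → ρ k ≤ m) ∧
      (∀ k, s k → ∃ j, s j ∧ ρ (k + 1) = j ∧ ρ k = j + 1) ∧
      (∀ k, ¬ s k → (∀ j, k = j + 1 → ¬ s j) → ρ k = k) := by
  classical
  have hex : ∀ k, ∃ j, k ≤ j ∧ ¬ s j := fun k => ⟨max k m, le_max_left _ _, hm _ (le_max_right _ _)⟩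
  let r : ℕ → ℕ := fun k => Nat.find (hex k)
  have r1 : ∀ k, k ≤ r k := fun k => (Nat.find_spec (hex k)).1
  have r2 : ∀ k, ¬ s (r k) := fun k => (Nat.find_spec (hex k)).2
  have r3 : ∀ k j, k ≤ j → j < r k → s j := fun k j h1 h2 => by
    have := Nat.find_min (hex k) h2
    by_contra h
    exact this ⟨h1, h⟩
  have r4 : ∀ k j, k ≤ j → ¬ s j → r k ≤ j := fun k j h1 h2 => Nat.find_min' (hex k) ⟨h1, h2⟩
  have l1 : ∀ k, lft s k ≤ k := by
    intro k
    induction k with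
    | zero => simp [lft]
    | succ k ih => simp only [lft]; split_ifs <;> omega
  have l2 : ∀ k j, lft s k ≤ j → j < k → s j := by
    intro k
    induction k with
    | zero => intro j _ h; omega
    | succ k ih =>
      intro j h1 h2
      simp only [lft] at h1
      split_ifs at h1 with h
      · rcases Nat.lt_succ_iff_lt_or_eq.1 h2 with h3 | h3
        · exact ih j h1 h3
        · exact h3 ▸ h
      · omega
  have rs : ∀ k, s k → r (k + 1) = r k := by
    intro k hk
    apply le_antisymm
    · apply r4 _ _ _ (r2 k)
      rcases (r1 k).lt_or_eq with h | h
      · exact h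
      · exact absurd hk (h ▸ r2 k)
    · exact r4 _ _ (by have := r1 (k+1); omega) (r2 _)
  have ls : ∀ k, s k → lft s (k + 1) = lft s k := by
    intro k hk; simp [lft, hk]
  have const : ∀ d a, (∀ j, a ≤ j → j < a + d → s j) → lft s (a + d) = lft s a ∧ r (a + d) = r a := by
    intro d
    induction d with
    | zero => intro a _; simp
    | succ d ih =>
      intro a h
      have := ih a (fun j h1 h2 => h j h1 (by omega))
      have hs := h (a + d) (by omega) (by omega)
      rw [← add_assoc, ls _ hs, rs _ hs]
      exact this
  have blk : ∀ k j, lft s k ≤ j → j ≤ r k → lft s j = lft s k ∧ r j = r k := by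
    intro k j h1 h2
    rcases le_total j k with h | h
    · obtain ⟨d, rfl⟩ := Nat.exists_eq_add_of_le h
      have := const d j (fun i a b => l2 _ i (by omega) b)
      exact ⟨this.1.symm, this.2.symm⟩
    · obtain ⟨d, rfl⟩ := Nat.exists_eq_add_of_le h
      exact const d k (fun i a b => r3 k i a (by omega))
  refine ⟨fun k => lft s k + r k - k, ?_, ?_, ?_, ?_⟩
  · intro k
    have a := l1 k
    have b := r1 k
    obtain ⟨h1, h2⟩ := blk k (lft s k + r k - k) (by omega) (by omega)
    simp only [h1, h2]
    omega
  · intro k hk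
    have a := l1 k
    have := r4 k m hk (hm m le_rfl)
    show lft s k + r k - k ≤ m
    omega
  · intro k hk
    have a := l1 k
    have b := r1 (k+1)
    rw [rs k hk] at b
    refine ⟨lft s k + r k - (k + 1), ?_, ?_, ?_⟩
    · rcases le_total k (lft s k + r k - (k + 1)) with h | h
      · exact r3 k _ h (by omega)
      · rcases h.lt_or_eq with h | h
        · exact l2 k _ (by omega) h
        · rw [h]; exact hk
    · simp only [ls k hk, rs k hk]
    · show lft s k + r k - k = _
      omega
  · intro k hk h
    have e : r k = k := le_antisymm (r4 k k le_rfl hk) (r1 k)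
    have e2 : lft s k = k := by
      cases k with
      | zero => simp [lft]
      | succ k => simp [lft, h k rfl]
    show lft s k + r k - k = k
    omega

lemma fin_val_add_one {m : ℕ} (i : Fin (m + 1)) (h : i + 1 ≠ 0) : ((i + 1 : Fin (m+1)) : ℕ) = i + 1 := by
  apply Fin.val_add_one_of_lt
  rw [Fin.lt_last_iff_ne_last]
  rintro rfl
  exact h (by simp)

lemma fin_ind {m : ℕ} (P : Fin (m + 1) → Prop) (h0 : P 0) (hs : ∀ i, P i → P (i + 1)) : ∀ i, P i := by
  intro i
  induction i using Fin.induction with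
  | zero => exact h0
  | succ i ih => have := hs _ ih; rwa [Fin.coeSucc_eq_succ] at this

lemma rho_fin {m : ℕ} (b : Fin (m + 1) → Bool) :
    ∃ ρ : Equiv.Perm (Fin (m + 1)), (∀ i, ρ (ρ i) = i) ∧ ρ 0 = 0 ∧
      (∀ i, i ≠ 0 → i + 1 ≠ 0 → b i = false → b (i + 1) = false →
        ∃ j, j ≠ 0 ∧ j + 1 ≠ 0 ∧ b j = false ∧ b (j + 1) = false ∧ ρ (i + 1) = j ∧ ρ i = j + 1) ∧
      (∀ i, b i = true → ρ i = i) := by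
  obtain ⟨ρ, h1, h2, h3, h4⟩ := rho_nat
    (fun k => ∃ i : Fin (m+1), (i : ℕ) = k ∧ i ≠ 0 ∧ i + 1 ≠ 0 ∧ b i = false ∧ b (i + 1) = false) m (by
      rintro k hk ⟨i, rfl, h0, h1, -⟩
      have := fin_val_add_one i h1
      have := (i+1).2
      omega)
  let f : Fin (m+1) → Fin (m+1) := fun i => ⟨ρ i, Nat.lt_succ_of_le (h2 i (Nat.le_of_lt_succ i.2))⟩
  have hf : Function.Involutive f := fun i => Fin.ext (h1 i)
  refine ⟨hf.toPerm, hf, ?_, ?_, ?_⟩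
  · apply Fin.ext
    show ρ 0 = 0
    apply h4
    · rintro ⟨i, hi, h0, -⟩
      exact h0 (Fin.ext hi)
    · intro j hj; omega
  · intro i a1 a2 a3 a4
    obtain ⟨j, ⟨j', rfl, b1, b2, b3, b4⟩, e1, e2⟩ := h3 i ⟨i, rfl, a1, a2, a3, a4⟩
    refine ⟨j', b1, b2, b3, b4, Fin.ext ?_, Fin.ext ?_⟩
    · show ρ _ = _
      rw [fin_val_add_one i a2, e1]
    · show ρ _ = _
      rw [fin_val_add_one j' b2, e2]
  · intro i hi
    apply Fin.ext
    show ρ i = i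
    apply h4
    · rintro ⟨j, e, -, -, hj, -⟩
      obtain rfl := Fin.ext e
      simp_all
    · rintro k hk ⟨j, rfl, -, hj, -, hj2⟩
      have : j + 1 = i := Fin.ext (by rw [fin_val_add_one j hj, hk])
      simp_all

/-- common part -/
def Base {m : ℕ} (p : Equiv.Perm (Fin (m+1)) × (Fin (m+1) → Bool)) : Prop :=
  p.1 0 = 0 ∧ p.2 0 = false ∧ (∀ i, i ≠ 0 → i + 1 = 0 → p.2 i = true)

def DA {m : ℕ} (p : Equiv.Perm (Fin (m+1)) × (Fin (m+1) → Bool)) : Prop :=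
  Base p ∧ ∀ i, i ≠ 0 → i + 1 ≠ 0 → p.2 i = p.2 (i+1) → p.1 (i+1) < p.1 i

def DB {m : ℕ} (p : Equiv.Perm (Fin (m+1)) × (Fin (m+1) → Bool)) : Prop :=
  Base p ∧ (∀ i, i ≠ 0 → i + 1 ≠ 0 → p.2 i = true → p.2 (i+1) = true → p.1 (i+1) < p.1 i) ∧
    (∀ i, i ≠ 0 → i + 1 ≠ 0 → p.2 i = false → p.2 (i+1) = false → p.1 i < p.1 (i + 1))

lemma equivAB (m : ℕ) : Nonempty ({p : Equiv.Perm (Fin (m+1)) × (Fin (m+1) → Bool) // DA p} ≃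
    {p : Equiv.Perm (Fin (m+1)) × (Fin (m+1) → Bool) // DB p}) := by
  choose ρ h1 h2 h3 h4 using fun b : Fin (m+1) → Bool => rho_fin b
  have hh : ∀ b, ρ b * ρ b = 1 := fun b => Equiv.ext (h1 b)
  refine ⟨⟨fun p => ⟨(p.1.1 * ρ p.1.2, p.1.2), ?_⟩, fun p => ⟨(p.1.1 * ρ p.1.2, p.1.2), ?_⟩, ?_, ?_⟩⟩
  · obtain ⟨⟨w, b⟩, ⟨c1, c2, c3⟩, c4⟩ := p
    dsimp only at *
    refine ⟨⟨by simp [h2, c1], c2, c3⟩, ?_, ?_⟩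
    · intro i a1 a2 a3 a4
      dsimp only at *
      simp only [Equiv.Perm.mul_apply, h4 _ _ a3, h4 _ _ a4]
      exact c4 i a1 a2 (a3.trans a4.symm)
    · intro i a1 a2 a3 a4
      dsimp only at *
      obtain ⟨j, d1, d2, d3, d4, d5, d6⟩ := h3 b i a1 a2 a3 a4
      simp only [Equiv.Perm.mul_apply, d5, d6]
      exact c4 j d1 d2 (d3.trans d4.symm)
  · obtain ⟨⟨w, b⟩, ⟨c1, c2, c3⟩, c4, c5⟩ := p
    dsimp only at *
    refine ⟨⟨by simp [h2, c1], c2, c3⟩, ?_⟩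
    intro i a1 a2 a3
    dsimp only at *
    cases hb : b i with
    | true =>
      have hb' := a3.symm.trans hb
      simp only [Equiv.Perm.mul_apply, h4 _ _ hb, h4 _ _ hb']
      exact c4 i a1 a2 hb hb'
    | false =>
      have hb' := a3.symm.trans hb
      obtain ⟨j, d1, d2, d3, d4, d5, d6⟩ := h3 b i a1 a2 hb hb'
      simp only [Equiv.Perm.mul_apply, d5, d6]
      exact c5 j d1 d2 d3 d4
  · intro p
    apply Subtype.ext
    simp [mul_assoc, hh]
  · intro p
    apply Subtype.ext
    simp [mul_assoc, hh]

lemma exists_word {m : ℕ} (π : Equiv.Perm (Fin (m+1))) (h : ∀ c, π.SameCycle 0 c) :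
    ∃ w : Equiv.Perm (Fin (m+1)), w 0 = 0 ∧ ∀ i, π (w i) = w (i + 1) := by
  have hc : π.IsCycleOn ((Finset.univ : Finset (Fin (m+1))) : Set (Fin (m+1))) := by
    refine ⟨by simpa using Set.bijOn_univ.2 π.bijective, fun x _ y _ => (h x).symm.trans (h y)⟩
  let f : Fin (m+1) → Fin (m+1) := fun i => (π ^ (i : ℕ)) 0
  have hs : Function.Surjective f := by
    intro c
    obtain ⟨k, hk, e⟩ := hc.exists_pow_eq (Finset.mem_univ 0) (Finset.mem_univ c)
    exact ⟨⟨k, by simpa using hk⟩, e⟩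
  refine ⟨Equiv.ofBijective f (Finite.injective_iff_bijective.1 (Finite.injective_iff_surjective.2 hs)), ?_, ?_⟩
  · simp [f]
  · intro i
    show π ((π ^ (i : ℕ)) 0) = (π ^ ((i + 1 : Fin (m+1)) : ℕ)) 0
    rw [← Equiv.Perm.mul_apply, ← pow_succ']
    by_cases hi : i + 1 = 0
    · have e : (i : ℕ) + 1 = m + 1 := by
        have : i = Fin.last m := by
          by_contra hne
          have := Fin.val_add_one_of_lt (Fin.lt_last_iff_ne_last.2 hne)
          rw [hi] at this
          simp at this
        simp [this]
      rw [hi, e]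
      simpa using hc.pow_card_apply (Finset.mem_univ 0)
    · rw [fin_val_add_one i hi]

lemma sc_of_word {m : ℕ} (π w : Equiv.Perm (Fin (m+1))) (h0 : w 0 = 0)
    (h : ∀ i, π (w i) = w (i + 1)) (c : Fin (m+1)) : π.SameCycle 0 c := by
  obtain ⟨i, rfl⟩ := w.surjective c
  revert i
  apply fin_ind
  · rw [h0]
  · intro i hi
    rw [← h]
    exact Equiv.Perm.sameCycle_apply_right.2 hi

lemma cyc_iff {m : ℕ} (π : Equiv.Perm (Fin (m+1))) : cyc π = 1 ↔ ∀ c, π.SameCycle 0 c := by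
  classical
  have m0 : (0 : Fin (m+1)) ∈ Finset.univ.filter fun c : Fin (m+1) => ∀ j, π.SameCycle c j → c ≤ j := by
    simp
  constructor
  · intro h c
    obtain ⟨a, ha⟩ := Finset.card_eq_one.1 h
    obtain ⟨e, he, hmin⟩ := Finset.exists_minimal (s := Finset.univ.filter fun j => π.SameCycle c j)
      ⟨c, by simpa using Equiv.Perm.SameCycle.refl π c⟩
    simp only [Finset.mem_filter, Finset.mem_univ, true_and] at he hmin
    have me : e ∈ Finset.univ.filter fun c : Fin (m+1) => ∀ j, π.SameCycle c j → c ≤ j := by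
      simp only [Finset.mem_filter, Finset.mem_univ, true_and]
      intro j hj
      rcases le_total e j with h | h
      · exact h
      · exact hmin (he.trans hj) h
    rw [ha] at m0 me
    have : e = 0 := (Finset.mem_singleton.1 me).trans (Finset.mem_singleton.1 m0).symm
    exact (this ▸ he).symm
  · intro h
    apply Finset.card_eq_one.2 ⟨0, ?_⟩
    ext c
    simp only [Finset.mem_filter, Finset.mem_univ, true_and, Finset.mem_singleton]
    constructor
    · intro hc
      have := hc 0 (h c).symm
      simpa using this
    · rintro rfl j _
      exact Fin.zero_le j

lemma mem_cdes {m : ℕ} (π w : Equiv.Perm (Fin (m+1))) (h0 : w 0 = 0)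
    (h : ∀ i, π (w i) = w (i + 1)) (i : Fin (m+1)) :
    w i ∈ cdesSet π ↔ i ≠ 0 ∧ i + 1 ≠ 0 ∧ w (i+1) < w i := by
  have sc := sc_of_word π w h0 h
  simp only [cdesSet, Finset.mem_filter, Finset.mem_univ, true_and, h]
  constructor
  · rintro ⟨a, j, -, hj⟩
    refine ⟨?_, ?_, a⟩
    · rintro rfl
      rw [h0] at a
      exact absurd a (Fin.not_lt_zero _)
    · intro e
      rw [e, h0] at hj
      exact absurd hj (Fin.not_lt_zero _)
  · rintro ⟨-, a, hh⟩
    refine ⟨hh, 0, (sc _).symm, ?_⟩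
    rw [Fin.pos_iff_ne_zero]
    intro e
    rw [← h0] at e
    exact a (w.injective e)

/-- the cyclic permutation of a word -/
def toCyc {m : ℕ} (w : Equiv.Perm (Fin (m+1))) : Equiv.Perm (Fin (m+1)) :=
  (w.symm.trans (Equiv.addRight 1)).trans w

lemma toCyc_apply {m : ℕ} (w : Equiv.Perm (Fin (m+1))) (i) : toCyc w (w i) = w (i + 1) := by
  simp [toCyc]

lemma word_unique {m : ℕ} (w w' : Equiv.Perm (Fin (m+1))) (h : w 0 = 0) (h' : w' 0 = 0)
    (e : toCyc w = toCyc w') : w = w' := by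
  apply Equiv.ext
  apply fin_ind
  · rw [h, h']
  · intro i hi
    rw [← toCyc_apply, hi, e, toCyc_apply]

/-- the sign function -/
def toSign {m : ℕ} (w : Equiv.Perm (Fin (m+1))) (b : Fin (m+1) → Bool) (c : Fin (m+1)) : Bool :=
  decide (w.symm c ≠ 0 ∧ w.symm c + 1 ≠ 0 ∧ b (w.symm c) = b (w.symm c + 1))

lemma sign_lift {m : ℕ} (s : Fin (m+1) → Bool) : ∃ b : Fin (m+1) → Bool, b 0 = false ∧
    (∀ i, i ≠ 0 → i + 1 = 0 → b i = true) ∧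
    (∀ i, i ≠ 0 → i + 1 ≠ 0 → (b i = b (i+1) ↔ s i = true)) := by
  classical
  have key : ∀ (t : ℕ → Bool) (d : ℕ), ∃ g : ℕ → Bool, g d = true ∧ ∀ k, k < d → (g k = g (k+1) ↔ t k = true) := by
    intro t d
    induction d generalizing t with
    | zero => exact ⟨fun _ => true, rfl, by simp⟩
    | succ d ih =>
      obtain ⟨g, h1, h2⟩ := ih (fun k => t (k+1))
      refine ⟨fun k => Nat.casesOn k (if t 0 then g 0 else !g 0) g, h1, ?_⟩
      intro k hk
      cases k with
      | zero => cases h : t 0 <;> simp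
      | succ k => exact h2 k (by omega)
  obtain ⟨g, h1, h2⟩ := key (fun k => if h : k < m + 1 then s ⟨k, h⟩ else false) m
  refine ⟨fun i => if i = 0 then false else g i, by simp, ?_, ?_⟩
  · intro i h hi
    have e : i = Fin.last m := by
      by_contra hne
      have := Fin.val_add_one_of_lt (Fin.lt_last_iff_ne_last.2 hne)
      rw [hi] at this
      simp at this
    subst e
    simp [h, h1]
  · intro i h hi
    have e := fin_val_add_one i hi
    have := (i+1).2
    simp only [h, hi, if_false, e]
    rw [h2 i (by omega)]
    simp only [i.2, dite_true]

lemma equivAX (m : ℕ) : Nonempty ({p : Equiv.Perm (Fin (m+1)) × (Fin (m+1) → Bool) // DA p} ≃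
    {p : Equiv.Perm (Fin (m+1)) × (Fin (m+1) → Bool) // IsNCD p ∧ cyc p.1 = 1}) := by
  refine ⟨Equiv.ofBijective (fun p => ⟨(toCyc p.1.1, toSign p.1.1 p.1.2), ?_, ?_⟩) ⟨?_, ?_⟩⟩
  · obtain ⟨⟨w, b⟩, ⟨c1, c2, c3⟩, c4⟩ := p
    intro c hc
    obtain ⟨i, rfl⟩ := w.surjective c
    simp only [toSign, Equiv.symm_apply_apply, decide_eq_true_eq] at hc
    exact (mem_cdes _ w c1 (toCyc_apply w) i).2 ⟨hc.1, hc.2.1, c4 i hc.1 hc.2.1 hc.2.2⟩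
  · exact (cyc_iff _).2 (sc_of_word _ p.1.1 p.2.1.1 (toCyc_apply _))
  · rintro ⟨⟨w, b⟩, ⟨c1, c2, c3⟩, c4⟩ ⟨⟨w', b'⟩, ⟨c1', c2', c3'⟩, c4'⟩ h
    simp only [Subtype.mk.injEq, Prod.mk.injEq] at h c1 c2 c3 c1' c2' c3'
    obtain ⟨h1, h2⟩ := h
    obtain rfl := word_unique _ _ c1 c1' h1
    have hb : ∀ i, i ≠ 0 → i + 1 ≠ 0 → (b i = b (i+1) ↔ b' i = b' (i+1)) := by
      intro i hi hi'
      have := congrFun h2 (w i)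
      simpa [toSign, hi, hi'] using this
    have : b = b' := by
      funext i
      induction i using Fin.reverseInduction with
      | last =>
        by_cases h : Fin.last m = 0
        · rw [h, c2, c2']
        · rw [c3 _ h (by simp), c3' _ h (by simp)]
      | cast i ih =>
        by_cases h : i.castSucc = 0
        · rw [h, c2, c2']
        · have := hb _ h (by rw [Fin.coeSucc_eq_succ]; exact Fin.succ_ne_zero i)
          rw [Fin.coeSucc_eq_succ, ih] at this
          revert this
          cases b i.castSucc <;> cases b' i.castSucc <;> cases b' i.succ <;> simp
    subst this
    rfl
  · rintro ⟨⟨π, φ⟩, h1, h2⟩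
    have sc := (cyc_iff _).1 h2
    obtain ⟨w, w0, hw⟩ := exists_word π sc
    obtain ⟨b, b0, b1, b2⟩ := sign_lift (fun i => φ (w i))
    have e : toCyc w = π := by
      ext c
      obtain ⟨i, rfl⟩ := w.surjective c
      rw [toCyc_apply, hw]
    refine ⟨⟨(w, b), ⟨w0, b0, b1⟩, ?_⟩, ?_⟩
    · intro i hi hi' h
      have := (b2 i hi hi').1 h
      exact ((mem_cdes π w w0 hw i).1 (h1 _ this)).2.2
    · apply Subtype.ext
      refine Prod.ext e ?_
      funext c
      obtain ⟨i, rfl⟩ := w.surjective c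
      rw [Bool.eq_iff_iff]
      simp only [toSign, Equiv.symm_apply_apply, decide_eq_true_eq]
      constructor
      · rintro ⟨a1, a2, a3⟩
        exact (b2 i a1 a2).1 a3
      · intro h
        have := (mem_cdes π w w0 hw i).1 (h1 _ h)
        exact ⟨this.1, this.2.1, (b2 i this.1 this.2.1).2 h⟩

/-- the matching of a word with bits, as a function -/
def toM {m : ℕ} (w : Equiv.Perm (Fin (m+1))) (b : Fin (m+1) → Bool) (v : Fin (m+1) × Bool) :
    Fin (m+1) × Bool :=
  if v.2 = b (w.symm v.1) then (w (w.symm v.1 - 1), !b (w.symm v.1 - 1))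
  else (w (w.symm v.1 + 1), b (w.symm v.1 + 1))

lemma toM_same {m : ℕ} (w : Equiv.Perm (Fin (m+1))) (b : Fin (m+1) → Bool) (i : Fin (m+1)) :
    toM w b (w i, b i) = (w (i - 1), !b (i - 1)) := by simp [toM]

lemma toM_flip {m : ℕ} (w : Equiv.Perm (Fin (m+1))) (b : Fin (m+1) → Bool) (i : Fin (m+1)) :
    toM w b (w i, !b i) = (w (i + 1), b (i + 1)) := by simp [toM]

lemma vcases {m : ℕ} (w : Equiv.Perm (Fin (m+1))) (b : Fin (m+1) → Bool) (v : Fin (m+1) × Bool) :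
    ∃ i, v = (w i, b i) ∨ v = (w i, !b i) := by
  obtain ⟨c, a⟩ := v
  obtain ⟨i, rfl⟩ := w.surjective c
  refine ⟨i, ?_⟩
  cases a <;> cases b i <;> simp

lemma toM_invol {m : ℕ} (w : Equiv.Perm (Fin (m+1))) (b : Fin (m+1) → Bool) :
    Function.Involutive (toM w b) := by
  intro v
  obtain ⟨i, rfl | rfl⟩ := vcases w b v
  · rw [toM_same, toM_flip]; simp
  · rw [toM_flip, toM_same]; simp

lemma sub_one_cases {m : ℕ} (i : Fin (m+1)) : ∃ j, i = j + 1 := ⟨i - 1, by simp⟩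

lemma toM_ne {m : ℕ} (w : Equiv.Perm (Fin (m+1))) (b : Fin (m+1) → Bool) (v) : toM w b v ≠ v := by
  have key : ∀ i, (w i, !b i) ≠ (w (i+1), b (i+1)) := by
    intro i h
    simp only [Prod.mk.injEq] at h
    have := w.injective h.1
    rw [← this] at h
    simp at h
  obtain ⟨i, rfl | rfl⟩ := vcases w b v
  · obtain ⟨j, rfl⟩ := sub_one_cases i
    rw [toM_same]
    simpa using key j
  · rw [toM_flip]
    exact (key i).symm

lemma toM_callan {m : ℕ} (w : Equiv.Perm (Fin (m+1))) (b : Fin (m+1) → Bool) (h0 : w 0 = 0) (hb : b 0 = false) :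
    (∀ i j : Fin (m+1), toM w b (i, false) = (j, true) → ¬ i < j) ↔ DB (w, b) := by
  have key : (∀ i j : Fin (m+1), toM w b (i, false) = (j, true) → ¬ i < j) ↔
      ((∀ i, b i = true → b (i+1) = true → ¬ w i < w (i+1)) ∧
        (∀ i, b i = false → b (i+1) = false → ¬ w (i+1) < w i)) := by
    constructor
    · intro h
      constructor
      · intro i h1 h2
        apply h
        have := toM_flip w b i
        rwa [h1, h2] at this
      · intro i h1 h2
        apply h
        have := toM_same w b (i+1)
        rw [add_sub_cancel_right, h1, h2] at this
        exact this
    · rintro ⟨h1, h2⟩ i j h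
      obtain ⟨k, hk | hk⟩ := vcases w b (i, false)
      · obtain ⟨l, rfl⟩ := sub_one_cases k
        rw [hk, toM_same] at h
        simp only [add_sub_cancel_right, Prod.mk.injEq, Bool.not_eq_true'] at h hk
        rw [hk.1, ← h.1]
        exact h2 l h.2 hk.2.symm
      · rw [hk, toM_flip] at h
        simp only [Prod.mk.injEq] at h hk
        rw [hk.1, ← h.1]
        exact h1 k (by simpa using hk.2.symm) h.2
  rw [key]
  have wne : ∀ i, i ≠ 0 → 0 < w i := by
    intro i hi
    rw [Fin.pos_iff_ne_zero, ← h0]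
    exact fun e => hi (w.injective e)
  have ne1 : ∀ i : Fin (m+1), i ≠ 0 → w (i+1) ≠ w i := by
    intro i hi e
    have := w.injective e
    have h1 : (1 : Fin (m+1)) = 0 := by simpa using this
    have : i = i * 1 := by simp
    rw [h1] at this
    simp at this
    exact hi this
  constructor
  · rintro ⟨h1, h2⟩
    refine ⟨⟨h0, hb, ?_⟩, ?_, ?_⟩
    · intro i hi hi'
      by_contra hf
      have hf : b i = false := by simpa using hf
      refine h2 i hf (by rw [hi', hb]) ?_
      rw [hi', h0]
      exact wne i hi
    · intro i hi _ a1 a2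
      exact lt_of_le_of_ne (not_lt.1 (h1 i a1 a2)) (ne1 i hi)
    · intro i hi _ a1 a2
      exact lt_of_le_of_ne (not_lt.1 (h2 i a1 a2)) (ne1 i hi).symm
  · rintro ⟨⟨-, -, h1⟩, h2, h3⟩
    constructor
    · intro i a1 a2
      have hi : i ≠ 0 := by rintro rfl; simp [hb] at a1
      have hi' : i + 1 ≠ 0 := by intro e; simp [e, hb] at a2
      exact not_lt.2 (h2 i hi hi' a1 a2).le
    · intro i a1 a2
      by_cases hi : i = 0
      · subst hi; rw [h0]; exact Fin.not_lt_zero _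
      · have hi' : i + 1 ≠ 0 := by
          intro e
          have : b i = true := h1 i hi e
          simp [a1] at this
        exact not_lt.2 (h3 i hi hi' a1 a2).le

lemma toM_conn {m : ℕ} (w : Equiv.Perm (Fin (m+1))) (b : Fin (m+1) → Bool) (h0 : w 0 = 0) :
    (matchGraph (toM_invol w b).toPerm).Connected := by
  rw [SimpleGraph.connected_iff_exists_forall_reachable]
  refine ⟨0, fun c => ?_⟩
  obtain ⟨i, rfl⟩ := w.surjective c
  revert i
  apply fin_ind
  · rw [h0]
  · intro i hi
    by_cases e : w i = w (i+1)
    · rwa [← e]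
    · refine hi.trans (SimpleGraph.Adj.reachable ?_)
      rw [matchGraph, SimpleGraph.fromRel_adj]
      exact ⟨e, Or.inl ⟨!b i, b (i+1), toM_flip w b i⟩⟩

lemma exists_of_conn {m : ℕ} (M : Equiv.Perm (Fin (m+1) × Bool)) (hM : IsPM M)
    (hc : (matchGraph M).Connected) : ∃ (w : Equiv.Perm (Fin (m+1))) (b : Fin (m+1) → Bool),
      w 0 = 0 ∧ b 0 = false ∧ (toM_invol w b).toPerm = M := by
  obtain ⟨hMM, hne⟩ := hM
  have MM : ∀ v, M (M v) = v := fun v => by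
    rw [← Equiv.Perm.mul_apply, hMM]; rfl
  let F : Equiv.Perm (Fin (m+1) × Bool) := Function.Involutive.toPerm (fun v => (v.1, !v.2)) (fun v => by simp)
  have Fap : ∀ v, F v = (v.1, !v.2) := fun v => rfl
  have FF : ∀ v, F (F v) = v := fun v => by simp [Fap]
  have Fne : ∀ v, F v ≠ v := fun v h => by
    have := congrArg Prod.snd h
    simp [Fap] at this
  let T : Equiv.Perm (Fin (m+1) × Bool) := M * F
  have Tap : ∀ v, T v = M (F v) := fun v => rfl
  have FT : ∀ v, T (F (T v)) = F v := fun v => by simp [Tap, FF, MM]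
  have FTp : ∀ (k : ℕ) v, (T ^ k) (F ((T ^ k) v)) = F v := by
    intro k
    induction k with
    | zero => intro v; simp
    | succ k ih =>
      intro v
      have e1 : (T ^ (k + 1)) v = T ((T ^ k) v) := by rw [pow_succ']; rfl
      have e2 : ∀ u, (T ^ (k + 1)) u = (T ^ k) (T u) := fun u => by rw [pow_succ]; rfl
      rw [e1, e2, FT, ih]
  have noflip : ∀ v, ¬ T.SameCycle v (F v) := by
    intro v h
    obtain ⟨k, hk⟩ := h.exists_nat_pow_eq
    obtain ⟨j, rfl | rfl⟩ := Nat.even_or_odd' k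
    · have := FTp j v
      rw [← hk, two_mul, pow_add, Equiv.Perm.mul_apply] at this
      exact Fne _ ((T ^ j).injective this)
    · have := FTp j v
      rw [← hk, two_mul, add_assoc, pow_add, Equiv.Perm.mul_apply] at this
      have := (T ^ j).injective this
      rw [pow_succ', Equiv.Perm.mul_apply, Tap] at this
      exact hne _ this.symm
  let x0 : Fin (m+1) × Bool := (0, false)
  have cover : ∀ c, ∃ a, T.SameCycle x0 (c, a) := by
    intro c
    have hr := hc.preconnected 0 c
    rw [SimpleGraph.reachable_iff_reflTransGen] at hr
    induction hr with
    | refl => exact ⟨false, Equiv.Perm.SameCycle.refl _ _⟩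
    | tail _ hadj ih =>
      rename_i i j _
      obtain ⟨a, ha⟩ := ih
      rw [matchGraph, SimpleGraph.fromRel_adj] at hadj
      have : ∃ p q, M (i, p) = (j, q) := by
        rcases hadj.2 with h | ⟨p, q, h⟩
        · exact h
        · exact ⟨q, p, by rw [← h, MM]⟩
      obtain ⟨p, q, h⟩ := this
      by_cases hp : p = a
      · subst hp
        refine ⟨!q, ?_⟩
        have e : T (j, !q) = (i, p) := by
          rw [Tap, Fap]
          simp only [Bool.not_not]
          rw [← h, MM]
        rw [← e] at ha
        exact Equiv.Perm.sameCycle_apply_right.1 ha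
      · refine ⟨q, ?_⟩
        have hp : p = !a := by revert hp; cases p <;> cases a <;> simp
        have e : T (i, a) = (j, q) := by rw [Tap, Fap, ← h, hp]
        rw [← e]
        exact Equiv.Perm.sameCycle_apply_right.2 ha
  choose β hβ using cover
  have uniq : ∀ v, T.SameCycle x0 v → v = (v.1, β v.1) := by
    rintro ⟨c, a⟩ hv
    by_contra hn
    have : F (c, β c) = (c, a) := by
      rw [Fap]
      revert hn
      cases a <;> cases h : β c <;> simp [h]
    exact noflip _ ((hβ c).symm.trans (this ▸ hv))
  have step : ∀ c, T (c, β c) = ((T (c, β c)).1, β (T (c, β c)).1) := fun c =>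
    uniq _ (Equiv.Perm.sameCycle_apply_right.2 (hβ c))
  have inj : Function.Injective (fun c => (T (c, β c)).1) := by
    intro c d h
    have h : (T (c, β c)).1 = (T (d, β d)).1 := h
    have : T (c, β c) = T (d, β d) := by rw [step c, step d, h]
    exact congrArg Prod.fst (T.injective this)
  let π : Equiv.Perm (Fin (m+1)) := Equiv.ofBijective _ (Finite.injective_iff_bijective.1 inj)
  have hπ : ∀ c, T (c, β c) = (π c, β (π c)) := step
  have β0 : β 0 = false := (congrArg Prod.snd (uniq x0 (Equiv.Perm.SameCycle.refl _ _))).symm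
  have powT : ∀ k : ℕ, (T ^ k) x0 = ((π ^ k) 0, β ((π ^ k) 0)) := by
    intro k
    induction k with
    | zero => simp [x0, β0]
    | succ k ih => rw [pow_succ', Equiv.Perm.mul_apply, ih, hπ, pow_succ', Equiv.Perm.mul_apply]
  have sc : ∀ c, π.SameCycle 0 c := by
    intro c
    obtain ⟨k, hk⟩ := (hβ c).exists_nat_pow_eq
    rw [powT] at hk
    exact ⟨k, by simpa using congrArg Prod.fst hk⟩
  obtain ⟨w, w0, hw⟩ := exists_word π sc
  refine ⟨w, fun i => β (w i), w0, by simp only [w0, β0], ?_⟩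
  have Mflip : ∀ i, M (w i, !β (w i)) = (w (i+1), β (w (i+1))) := by
    intro i
    have := hπ (w i)
    rwa [hw] at this
  ext1 v
  show toM w (fun i => β (w i)) v = M v
  obtain ⟨i, rfl | rfl⟩ := vcases w (fun i => β (w i)) v
  · obtain ⟨j, rfl⟩ := sub_one_cases i
    rw [toM_same w (fun i => β (w i)) (j+1), ← Mflip, MM]
    simp
  · rw [toM_flip w (fun i => β (w i)) i, Mflip]

lemma equivBY (m : ℕ) : Nonempty ({p : Equiv.Perm (Fin (m+1)) × (Fin (m+1) → Bool) // DB p} ≃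
    {M : Equiv.Perm (Fin (m+1) × Bool) // IsCallan M ∧ (matchGraph M).Connected}) := by
  refine ⟨Equiv.ofBijective (fun p => ⟨(toM_invol p.1.1 p.1.2).toPerm, ⟨⟨?_, ?_⟩, ?_⟩, ?_⟩) ⟨?_, ?_⟩⟩
  · ext1 v
    exact toM_invol _ _ v
  · exact toM_ne _ _
  · exact (toM_callan p.1.1 p.1.2 p.2.1.1 p.2.1.2.1).2 p.2
  · exact toM_conn _ _ p.2.1.1
  · rintro ⟨⟨w, b⟩, ⟨c1, c2, c3⟩, c4⟩ ⟨⟨w', b'⟩, ⟨c1', c2', c3'⟩, c4'⟩ h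
    simp only [Subtype.mk.injEq] at h c1 c2 c1' c2'
    have hM : ∀ v, toM w b v = toM w' b' v := fun v => congrArg (fun e : Equiv.Perm _ => e v) h
    have key : ∀ i, w i = w' i ∧ b i = b' i := by
      apply fin_ind
      · simp [c1, c2, c1', c2']
      · rintro i ⟨h1, h2⟩
        have := toM_flip w b i
        rw [h1, h2, hM, toM_flip] at this
        simp only [Prod.mk.injEq] at this
        exact ⟨this.1.symm, this.2.symm⟩
    obtain rfl : w = w' := Equiv.ext fun i => (key i).1
    obtain rfl : b = b' := funext fun i => (key i).2
    rfl
  · rintro ⟨M, ⟨hP, hC⟩, hG⟩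
    obtain ⟨w, b, w0, b0, rfl⟩ := exists_of_conn M hP hG
    exact ⟨⟨(w, b), (toM_callan w b w0 b0).1 hC⟩, rfl⟩

end NCDProof

/-- There is a bijection between cyclic negative cycle descent permutations of [n]
(those with exactly one cycle) and connected Callan perfect matchings of P_n. -/
theorem cyclic_ncd_equiv_connected_callan (n : ℕ) (hn : 1 ≤ n) :
    ∃ Θ : {p : Equiv.Perm (Fin n) × (Fin n → Bool) // IsNCD p ∧ cyc p.1 = 1} →
          {M : Equiv.Perm (Fin n × Bool) // IsCallan M ∧ (matchGraph M).Connected},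
      Function.Bijective Θ := by
  obtain ⟨m, rfl⟩ : ∃ m, n = m + 1 := ⟨n - 1, by omega⟩
  obtain ⟨e1⟩ := NCDProof.equivAX m
  obtain ⟨e2⟩ := NCDProof.equivAB m
  obtain ⟨e3⟩ := NCDProof.equivBY m
  exact ⟨_, ((e1.symm.trans e2).trans e3).bijective⟩
end
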